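/- For every integer n ≥ 301, the first-order forward difference of the partition function satisfies the Laguerre inequality of order 2: 3(Δp(n+2))^2 − 4(Δp(n+1))·(Δp(n+3)) + (Δp(n))·(Δp(n+4)) > 0. -/

import Mathlib

/-- The partition function: the number of partitions of `n`. -/
def partitionFn (n : ℕ) : ℕ := Fintype.card (Nat.Partition n)

/-- The first-order forward difference of the partition function, as an integer. -/
def dP (n : ℕ) : ℤ := (partitionFn (n + 1) : ℤ) - partitionFn n

set_option exponentiation.threshold 600

/-! ### Verification of small cases by packed arithmetic -/

/-- Apply `f` to `x`, making the kernel evaluate `x` to a literal first. -/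
@[reducible] def forceNat {α : Type} (x : ℕ) (f : ℕ → α) : α :=
  Nat.rec (motive := fun _ => α) (f 0) (fun n _ => f (n + 1)) x

theorem forceNat_eq {α : Type} (x : ℕ) (f : ℕ → α) : forceNat x f = f x := by
  cases x <;> rfl

/-- The power `B ^ n` of the base `B = 2 ^ 512`. -/
def basePow (n : ℕ) : ℕ := Nat.shiftLeft 1 (512 * n)

/-- The remainder of `v` modulo `B ^ n`. -/
def lowPart (v n : ℕ) : ℕ := Nat.land v (basePow n - 1)

/-- The quotient of `v` by `B ^ n`. -/
def highPart (v n : ℕ) : ℕ := Nat.shiftRight v (512 * n)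

/-- The part of the pentagonal series at `B` with `|k| < fuel` and `k` of the given parity. -/
def pentSum (fuel : ℕ) (odd : Bool) : ℕ :=
  Nat.rec (motive := fun _ => ℕ) 0 (fun k s =>
    cond (Nat.beq (k % 2) 1 == odd)
      (s + basePow (k * (3 * k + 1) / 2) + cond (Nat.beq k 0) 0 (basePow (k * (3 * k - 1) / 2)))
      s) fuel

/-- Newton iteration for the inverse of `ep - en` modulo a power of `B`. -/
def invNewton (ep en : ℕ) (fuel : ℕ) : ℕ :=
  Nat.rec (motive := fun _ => ℕ) 1 (fun j v =>
    forceNat v fun v =>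
    lowPart (v * (lowPart (v * (lowPart en (2 ^ (j + 1)))) (2 ^ (j + 1)) + 2 +
      (basePow (2 ^ (j + 1)) - lowPart (v * (lowPart ep (2 ^ (j + 1)))) (2 ^ (j + 1)))))
      (2 ^ (j + 1))) fuel

/-- The order two Laguerre inequality for the differences of six consecutive values. -/
def slotCheck (p0 p1 p2 p3 p4 p5 : ℕ) : Bool :=
  Nat.ble p0 p1 && (Nat.ble p1 p2 && (Nat.ble p2 p3 && (Nat.ble p3 p4 && (Nat.ble p4 p5 &&
    Nat.ble (4 * ((p2 - p1) * (p4 - p3)) + 1)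
      (3 * ((p3 - p2) * (p3 - p2)) + (p1 - p0) * (p5 - p4))))))

/-- The digit of index `i` of `v` in base `B`. -/
def slot (v i : ℕ) : ℕ := lowPart (highPart v i) 1

/-- Run `slotCheck` on all windows of `2 ^ d + 5` consecutive digits of `v`. -/
def blockCheck (d : ℕ) : ℕ → Bool :=
  Nat.rec (motive := fun _ => ℕ → Bool)
    (fun v => forceNat v fun v =>
      slotCheck (slot v 0) (slot v 1) (slot v 2) (slot v 3) (slot v 4) (slot v 5))
    (fun d ih v => forceNat v fun v =>
      ih (lowPart v (2 ^ d + 5)) && ih (highPart v (2 ^ d))) d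

/-- Compute the partition numbers below `16690` and check the inequality for them. -/
def fullCheck : Bool :=
  forceNat (lowPart (pentSum 106 false) 16690) fun ep =>
  forceNat (lowPart (pentSum 106 true) 16690) fun en =>
  forceNat (lowPart (invNewton ep en 15) 16690) fun v =>
  Nat.beq (lowPart (v * ep) 16690) (lowPart (v * en + 1) 16690) &&
    blockCheck 14 (highPart v 301)

theorem fullCheck_eq : fullCheck = true := by decide +kernel

theorem basePow_eq (n : ℕ) : basePow n = (2 ^ 512) ^ n := by
  have : basePow n = 1 <<< (512 * n) := rfl
  rw [this, Nat.one_shiftLeft, pow_mul]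

theorem lowPart_eq (v n : ℕ) : lowPart v n = v % (2 ^ 512) ^ n := by
  have : lowPart v n = v &&& (basePow n - 1) := rfl
  rw [this, basePow_eq, ← pow_mul, Nat.and_two_pow_sub_one_eq_mod]

theorem highPart_eq (v n : ℕ) : highPart v n = v / (2 ^ 512) ^ n := by
  have : highPart v n = v >>> (512 * n) := rfl
  rw [this, Nat.shiftRight_eq_div_pow, pow_mul]

/-- The number with base `B` digits `f lo, …, f (lo + len - 1)`. -/
def packed (B : ℕ) (f : ℕ → ℕ) (lo len : ℕ) : ℕ := ∑ i ∈ Finset.range len, f (lo + i) * B ^ i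

theorem packed_add (B : ℕ) (f : ℕ → ℕ) (lo a c : ℕ) :
    packed B f lo (a + c) = packed B f lo a + B ^ a * packed B f (lo + a) c := by
  simp only [packed, Finset.sum_range_add, Finset.mul_sum]
  congr 1
  refine Finset.sum_congr rfl fun i _ => ?_
  rw [pow_add, add_assoc]; ring

theorem packed_lt {B : ℕ} {f : ℕ → ℕ} (lo len : ℕ)
    (h : ∀ i < lo + len, f i < B) : packed B f lo len < B ^ len := by
  induction len with
  | zero => simp [packed]
  | succ n ih =>
    have h1 := ih fun i hi => h i (by omega)
    have h2 : f (lo + n) < B := h _ (by omega)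
    rw [packed_add]
    simp only [packed, Finset.sum_range_one, pow_zero, mul_one, add_zero] at h1 ⊢
    rw [pow_succ]
    nlinarith [Nat.mul_le_mul_left (B ^ n) (Nat.succ_le_of_lt h2)]

theorem packed_mod {B : ℕ} {f : ℕ → ℕ} (lo a c : ℕ)
    (h : ∀ i < lo + (a + c), f i < B) : packed B f lo (a + c) % B ^ a = packed B f lo a := by
  rw [packed_add, Nat.add_mul_mod_self_left, Nat.mod_eq_of_lt]
  exact packed_lt _ _ fun i hi => h i (by omega)

theorem packed_div {B : ℕ} {f : ℕ → ℕ} (hB : 0 < B) (lo a c : ℕ)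
    (h : ∀ i < lo + (a + c), f i < B) :
    packed B f lo (a + c) / B ^ a = packed B f (lo + a) c := by
  rw [packed_add, Nat.add_mul_div_left _ _ (pow_pos hB a), Nat.div_eq_of_lt, zero_add]
  exact packed_lt _ _ fun i hi => h i (by omega)

theorem slot_packed {f : ℕ → ℕ} (lo len i : ℕ) (hi : i < len)
    (h : ∀ i < lo + len, f i < 2 ^ 512) : slot (packed (2 ^ 512) f lo len) i = f (lo + i) := by
  obtain ⟨c, rfl⟩ := Nat.exists_eq_add_of_lt hi
  rw [slot, lowPart_eq, highPart_eq, show i + c + 1 = i + (1 + c) by ring,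
    packed_div (Nat.two_pow_pos 512) _ _ _ (fun j hj => h j (by omega)),
    packed_mod _ _ _ (fun j hj => h j (by omega))]
  simp [packed]

theorem blockCheck_zero (v : ℕ) : blockCheck 0 v =
    slotCheck (slot v 0) (slot v 1) (slot v 2) (slot v 3) (slot v 4) (slot v 5) :=
  forceNat_eq v fun v =>
    slotCheck (slot v 0) (slot v 1) (slot v 2) (slot v 3) (slot v 4) (slot v 5)

theorem blockCheck_succ (d v : ℕ) : blockCheck (d + 1) v =
    (blockCheck d (lowPart v (2 ^ d + 5)) && blockCheck d (highPart v (2 ^ d))) :=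
  forceNat_eq v fun v => (blockCheck d (lowPart v (2 ^ d + 5)) && blockCheck d (highPart v (2 ^ d)))

theorem blockCheck_packed {f : ℕ → ℕ} (d lo : ℕ) (h : ∀ i < lo + (2 ^ d + 5), f i < 2 ^ 512)
    (hc : blockCheck d (packed (2 ^ 512) f lo (2 ^ d + 5)) = true) (i : ℕ) (hi : i < 2 ^ d) :
    slotCheck (f (lo + i)) (f (lo + i + 1)) (f (lo + i + 2)) (f (lo + i + 3)) (f (lo + i + 4))
      (f (lo + i + 5)) = true := by
  induction d generalizing lo i with
  | zero =>
    obtain rfl : i = 0 := by simpa using hi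
    rw [blockCheck_zero] at hc
    rw [slot_packed _ _ _ (by norm_num) h, slot_packed _ _ _ (by norm_num) h,
      slot_packed _ _ _ (by norm_num) h, slot_packed _ _ _ (by norm_num) h,
      slot_packed _ _ _ (by norm_num) h, slot_packed _ _ _ (by norm_num) h] at hc
    exact hc
  | succ d ih =>
    have hp : 2 ^ (d + 1) = 2 ^ d + 2 ^ d := by ring
    rw [blockCheck_succ, Bool.and_eq_true, lowPart_eq, highPart_eq] at hc
    obtain ⟨h1, h2⟩ := hc
    rw [show 2 ^ (d + 1) + 5 = (2 ^ d + 5) + 2 ^ d by omega,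
      packed_mod _ _ _ (fun j hj => h j (by omega))] at h1
    rw [show 2 ^ (d + 1) + 5 = 2 ^ d + (2 ^ d + 5) by omega,
      packed_div (Nat.two_pow_pos 512) _ _ _ (fun j hj => h j (by omega))] at h2
    rcases lt_or_ge i (2 ^ d) with hlt | hge
    · exact ih lo (fun j hj => h j (by omega)) h1 i hlt
    · have := ih (lo + 2 ^ d) (fun j hj => h j (by omega)) h2 (i - 2 ^ d) (by omega)
      rwa [show lo + 2 ^ d + (i - 2 ^ d) = lo + i by omega] at this

theorem slotCheck_dP {n : ℕ}
    (h : slotCheck (partitionFn n) (partitionFn (n + 1)) (partitionFn (n + 2)) (partitionFn (n + 3))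
      (partitionFn (n + 4)) (partitionFn (n + 5)) = true) :
    3 * (dP (n + 2)) ^ 2 - 4 * dP (n + 1) * dP (n + 3) + dP n * dP (n + 4) > 0 := by
  simp only [slotCheck, Bool.and_eq_true, Nat.ble_eq] at h
  obtain ⟨h0, h1, h2, h3, h4, h5⟩ := h
  zify [h0, h1, h2, h3, h4] at h5
  simp only [dP]
  linarith

open PowerSeries PowerSeries.WithPiTopology in
theorem hasProd_partitionFn (R : Type*) [CommRing R] [TopologicalSpace R] [T2Space R] [IsTopologicalRing R] :
    HasProd (fun i ↦ ∑' j : ℕ, (X : R⟦X⟧) ^ ((i + 1) * j))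
      (PowerSeries.mk fun n ↦ (partitionFn n : R)) := by
  have h := Nat.Partition.hasProd_powerSeriesMk_card_restricted R (fun _ => True)
  simpa [Nat.Partition.restricted, partitionFn] using h

open PowerSeries PowerSeries.WithPiTopology in
theorem partition_mul_pentagonal :
    (PowerSeries.mk fun n ↦ (partitionFn n : ℤ)) * pentagonalSeries ℤ = 1 := by
  have h1 := hasProd_partitionFn ℤ
  have h2 := hasProd_one_sub_X_pow ℤ
  have h3 := h1.mul h2
  refine h3.unique ?_
  convert hasProd_one with i
  have : ∀ j : ℕ, (X : ℤ⟦X⟧) ^ ((i + 1) * j) = (X ^ (i + 1)) ^ j := fun j => pow_mul _ _ _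
  simp_rw [this]
  exact tsum_pow_mul_one_sub_of_constantCoeff_eq_zero (by simp)

/-- The pentagonal polynomial with exponents `pentagonal k`, `|k| < K`. -/
noncomputable def pentPoly (K : ℕ) : Polynomial ℤ :=
  ∑ k ∈ Finset.Ioo (-(K : ℤ)) K, Polynomial.monomial (pentagonal k) ((Int.negOnePow k : ℤˣ) : ℤ)

theorem lt_pentagonal_of_le_natAbs {K : ℕ} {k : ℤ} (h : K ≤ k.natAbs) :
    K * (3 * K - 1) / 2 ≤ pentagonal k := by
  have h1 := two_mul_natCast_pentagonal k
  rcases Nat.eq_zero_or_pos K with rfl | hK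
  · simp
  have h2 : (K : ℤ) * (3 * K - 1) ≤ 2 * pentagonal k := by
    rw [h1]
    have hK' : (1 : ℤ) ≤ K := by exact_mod_cast hK
    rcases le_total 0 k with hk | hk
    · have h3 : (K : ℤ) ≤ k := by omega
      nlinarith [mul_nonneg (sub_nonneg.2 h3) (show (0 : ℤ) ≤ 3 * (k + K) - 1 by omega)]
    · have h3 : (K : ℤ) ≤ -k := by omega
      nlinarith [mul_nonneg (sub_nonneg.2 h3) (show (0 : ℤ) ≤ 3 * (-k + K) - 1 by omega)]
  · have : K * (3 * K - 1) ≤ 2 * pentagonal k := by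
      zify [show 1 ≤ 3 * K by omega]; exact h2
    omega

theorem coeff_pentPoly {K n : ℕ} (hn : n < K * (3 * K - 1) / 2) :
    (pentPoly K).coeff n = (PowerSeries.pentagonalSeries ℤ).coeff n := by
  rw [pentPoly, Polynomial.finsetSum_coeff]
  simp_rw [Polynomial.coeff_monomial]
  by_cases h : n ∈ Set.range pentagonal
  · obtain ⟨k, rfl⟩ := h
    have hk : k ∈ Finset.Ioo (-(K : ℤ)) K := by
      by_contra hk
      have : K ≤ k.natAbs := by
        rw [Finset.mem_Ioo] at hk; omega
      have := lt_pentagonal_of_le_natAbs this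
      omega
    simp only [pentagonal_inj]
    rw [Finset.sum_ite_eq' _ k, if_pos hk, PowerSeries.coeff_pentagonalSeries_pentagonal]
    rfl
  · rw [PowerSeries.coeff_pentagonalSeries_eq_zero _ h]
    refine Finset.sum_eq_zero fun k _ => if_neg fun hk => h ⟨k, hk⟩

theorem pentSum_succ (K : ℕ) (b : Bool) : pentSum (K + 1) b =
    cond (Nat.beq (K % 2) 1 == b)
      (pentSum K b + basePow (K * (3 * K + 1) / 2) +
        cond (Nat.beq K 0) 0 (basePow (K * (3 * K - 1) / 2))) (pentSum K b) := rfl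

theorem eval_pentPoly (K : ℕ) :
    (pentPoly K).eval (2 ^ 512 : ℤ) = (pentSum K false : ℤ) - pentSum K true := by
  induction K with
  | zero => simp [pentPoly, pentSum]
  | succ K ih =>
    have hp1 : pentagonal (K : ℤ) = K * (3 * K - 1) / 2 := by
      rcases Nat.eq_zero_or_pos K with rfl | hK
      · simp [pentagonal_def]
      · rw [pentagonal_def]; zify [show 1 ≤ 3 * K by omega]
        rw [Int.toNat_of_nonneg]
        exact Int.ediv_nonneg (mul_nonneg (by omega) (by omega)) (by norm_num)
    have hp2 : pentagonal (-(K : ℤ)) = K * (3 * K + 1) / 2 := by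
      rw [pentagonal_neg]; zify
      rw [Int.toNat_of_nonneg]
      positivity
    rcases Nat.eq_zero_or_pos K with rfl | hK
    · have : Finset.Ioo (-((0 + 1 : ℕ) : ℤ)) ((0 + 1 : ℕ) : ℤ) = {0} := by decide
      rw [pentPoly, this]
      simp [pentSum, basePow_eq, pentagonal_def, show Nat.beq 0 1 = false from rfl]
    · have hI : Finset.Ioo (-((K + 1 : ℕ) : ℤ)) ((K + 1 : ℕ) : ℤ) =
          insert (K : ℤ) (insert (-(K : ℤ)) (Finset.Ioo (-(K : ℤ)) K)) := by
        ext x; simp only [Finset.mem_Ioo, Finset.mem_insert]; omega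
      have hn1 : (-(K : ℤ)) ∉ Finset.Ioo (-(K : ℤ)) K := by simp
      have hn2 : (K : ℤ) ∉ insert (-(K : ℤ)) (Finset.Ioo (-(K : ℤ)) K) := by
        simp; omega
      rw [pentPoly, hI, Finset.sum_insert hn2, Finset.sum_insert hn1, ← pentPoly,
        Polynomial.eval_add, Polynomial.eval_add, ih, Polynomial.eval_monomial,
        Polynomial.eval_monomial, hp1, hp2, pentSum_succ, pentSum_succ, basePow_eq, basePow_eq,
        Int.negOnePow_neg]
      have hb : Nat.beq K 0 = false := by
        cases K with
        | zero => omega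
        | succ n => rfl
      rw [hb]
      rcases Nat.even_or_odd K with he | ho
      · have h1 : Nat.beq (K % 2) 1 = false := by rw [Nat.even_iff.mp he]; rfl
        have h2 : Int.negOnePow (K : ℤ) = 1 := Int.negOnePow_even _ (by exact_mod_cast he)
        rw [h1, h2]
        simp only [beq_self_eq_true, cond_true, cond_false, Bool.false_beq, Bool.not_true]
        push_cast
        ring
      · have h1 : Nat.beq (K % 2) 1 = true := by rw [Nat.odd_iff.mp ho]; rfl
        have h2 : Int.negOnePow (K : ℤ) = -1 := Int.negOnePow_odd _ (by exact_mod_cast ho)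
        rw [h1, h2]
        simp only [beq_self_eq_true, cond_true, cond_false, Bool.true_beq]
        push_cast
        ring

theorem dvd_packed_mul_sub_one {K N : ℕ} (hN : N ≤ K * (3 * K - 1) / 2) :
    ((2 ^ 512) ^ N : ℤ) ∣ (packed (2 ^ 512) partitionFn 0 N : ℤ) *
      ((pentSum K false : ℤ) - pentSum K true) - 1 := by
  set P : PowerSeries ℤ := PowerSeries.mk fun n ↦ (partitionFn n : ℤ) with hP
  have hd : (Polynomial.X : Polynomial ℤ) ^ N ∣ P.trunc N * pentPoly K - 1 := by
    rw [Polynomial.X_pow_dvd_iff]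
    intro d hd
    have h1 : (PowerSeries.coeff d) (P * PowerSeries.pentagonalSeries ℤ) =
        if d = 0 then 1 else 0 := by
      rw [hP, partition_mul_pentagonal, PowerSeries.coeff_one]
    rw [Polynomial.coeff_sub, Polynomial.coeff_mul, Polynomial.coeff_one, sub_eq_zero, ← h1,
      PowerSeries.coeff_mul]
    refine Finset.sum_congr rfl fun x hx => ?_
    have hx' := Finset.HasAntidiagonal.mem_antidiagonal.mp hx
    rw [PowerSeries.coeff_trunc, if_pos (by omega), coeff_pentPoly (by omega)]
  have he := Polynomial.eval_dvd (x := (2 ^ 512 : ℤ)) hd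
  rw [Polynomial.eval_sub, Polynomial.eval_mul, Polynomial.eval_pow, Polynomial.eval_X,
    Polynomial.eval_one, eval_pentPoly] at he
  have hp : Polynomial.eval (2 ^ 512 : ℤ) (P.trunc N) = (packed (2 ^ 512) partitionFn 0 N : ℤ) := by
    rw [← Polynomial.eval₂_id, PowerSeries.eval₂_trunc_eq_sum_range]
    simp only [packed, hP, PowerSeries.coeff_mk, zero_add, Nat.cast_sum, Nat.cast_mul, Nat.cast_pow,
      Nat.cast_ofNat, RingHom.id_apply]
  rw [hp] at he
  exact he

theorem modEq_of_lowPart {v a b N : ℕ}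
    (h : lowPart (v * lowPart a N) N = lowPart (v * lowPart b N + 1) N) :
    v * a ≡ v * b + 1 [MOD (2 ^ 512) ^ N] := by
  simp only [lowPart_eq] at h
  refine (Nat.ModEq.mul_left _ (Nat.mod_modEq _ _).symm).trans (Nat.ModEq.trans h ?_)
  exact Nat.ModEq.add_right _ (Nat.ModEq.mul_left _ (Nat.mod_modEq _ _))

theorem exists_blockCheck : ∃ v : ℕ, v < (2 ^ 512) ^ 16690 ∧
    v * pentSum 106 false ≡ v * pentSum 106 true + 1 [MOD (2 ^ 512) ^ 16690] ∧
    blockCheck 14 (v / (2 ^ 512) ^ 301) = true := by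
  have h := fullCheck_eq
  rw [fullCheck, forceNat_eq, forceNat_eq, forceNat_eq, Bool.and_eq_true, Nat.beq_eq,
    highPart_eq] at h
  refine ⟨_, ?_, modEq_of_lowPart h.1, h.2⟩
  rw [lowPart_eq]
  exact Nat.mod_lt _ (pow_pos (Nat.two_pow_pos 512) _)

theorem eq_packed_of_modEq {K N v : ℕ} (hN : N ≤ K * (3 * K - 1) / 2)
    (hp : ∀ i < N, partitionFn i < 2 ^ 512) (hv : v < (2 ^ 512) ^ N)
    (h : v * pentSum K false ≡ v * pentSum K true + 1 [MOD (2 ^ 512) ^ N]) :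
    v = packed (2 ^ 512) partitionFn 0 N := by
  have hd := dvd_packed_mul_sub_one hN
  have hlt : packed (2 ^ 512) partitionFn 0 N < (2 ^ 512) ^ N :=
    packed_lt 0 N fun i hi => hp i (by omega)
  have h1 := h.dvd
  generalize packed (2 ^ 512) partitionFn 0 N = P at *
  generalize pentSum K false = a at *
  generalize pentSum K true = b at *
  have hcast : (((2 ^ 512) ^ N : ℕ) : ℤ) = ((2 ^ 512) ^ N : ℤ) := by push_cast; rfl
  have hd' : (((2 ^ 512) ^ N : ℕ) : ℤ) ∣ (P : ℤ) * ((a : ℤ) - b) - 1 := by rw [hcast]; exact hd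
  generalize (2 ^ 512) ^ N = M at hv hlt h1 hd'
  have h2 : (M : ℤ) ∣ (P : ℤ) - v := by
    have := (hd'.mul_left v).add (h1.mul_left P)
    have he : (P : ℤ) - v = v * (P * (a - b) - 1) + P * (((v * b + 1 : ℕ) : ℤ) - (v * a : ℕ)) := by
      push_cast; ring
    rw [he]
    exact this
  exact Nat.ModEq.eq_of_lt_of_lt ((Nat.modEq_iff_dvd).2 h2) hv hlt

theorem laguerre2_dP_of_lt {n : ℕ} (hp : ∀ i < 16690, partitionFn i < 2 ^ 512)
    (h1 : 301 ≤ n) (h2 : n < 16685) :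
    3 * (dP (n + 2)) ^ 2 - 4 * dP (n + 1) * dP (n + 3) + dP n * dP (n + 4) > 0 := by
  obtain ⟨v, hv, hm, hc⟩ := exists_blockCheck
  have hN : 16690 = 301 + (2 ^ 14 + 5) := by norm_num
  have hK : 16690 ≤ 106 * (3 * 106 - 1) / 2 := by norm_num
  generalize 16690 = N at hN hK hp hv hm
  have hv' := eq_packed_of_modEq hK hp hv hm
  have hdiv := packed_div (B := 2 ^ 512) (f := partitionFn) (by positivity) 0 301 (2 ^ 14 + 5)
    (fun j hj => hp j (by omega))
  rw [hv', hN, hdiv] at hc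
  have := blockCheck_packed 14 (0 + 301) (fun j hj => hp j (by omega)) hc (n - 301) (by omega)
  rw [show 0 + 301 + (n - 301) = n by omega] at this
  exact slotCheck_dP this

/-! ### The generating function -/

open PowerSeries PowerSeries.WithPiTopology in
/-- The generating function of the partitions into parts of size at most `K`. -/
noncomputable def partialGF (K : ℕ) : ℤ⟦X⟧ :=
  ∏ i ∈ Finset.range K, PowerSeries.mk fun n => if (i + 1) ∣ n then 1 else 0

open PowerSeries PowerSeries.WithPiTopology in
theorem tsum_X_pow_mul (i : ℕ) : (∑' j : ℕ, (X : ℤ⟦X⟧) ^ ((i + 1) * j)) =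
    PowerSeries.mk fun n => if (i + 1) ∣ n then 1 else 0 := by
  have h0 : (∑' j : ℕ, ((X : ℤ⟦X⟧) ^ (i + 1)) ^ j) * (1 - X ^ (i + 1)) = 1 :=
    tsum_pow_mul_one_sub_of_constantCoeff_eq_zero (by simp)
  simp_rw [pow_mul]
  have h1 : (PowerSeries.mk fun n => if (i + 1) ∣ n then (1 : ℤ) else 0) * (1 - X ^ (i + 1)) = 1 := by
    ext n
    rw [mul_sub, mul_one, map_sub, coeff_mul_X_pow', coeff_mk, coeff_one]
    by_cases hn : i + 1 ≤ n
    · obtain ⟨c, rfl⟩ := Nat.exists_eq_add_of_le hn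
      simp
    · rw [if_neg hn]
      rcases Nat.eq_zero_or_pos n with rfl | hpos
      · simp
      · rw [if_neg fun h => hn (Nat.le_of_dvd hpos h), if_neg hpos.ne']; simp
  calc _ = (∑' j : ℕ, ((X : ℤ⟦X⟧) ^ (i + 1)) ^ j) * ((PowerSeries.mk fun n =>
        if (i + 1) ∣ n then (1 : ℤ) else 0) * (1 - X ^ (i + 1))) := by rw [h1, mul_one]
    _ = _ := by rw [mul_comm (PowerSeries.mk _), ← mul_assoc, h0, one_mul]

open PowerSeries PowerSeries.WithPiTopology Filter Topology in
theorem tendsto_coeff_partialGF (n : ℕ) :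
    Tendsto (fun K => (partialGF K).coeff n) atTop (𝓝 (partitionFn n : ℤ)) := by
  have h := (hasProd_partitionFn ℤ).tendsto_prod_nat
  simp_rw [tsum_X_pow_mul] at h
  have h2 := ((continuous_coeff ℤ n).tendsto _).comp h
  simpa [Function.comp_def, partialGF] using h2

open PowerSeries in
theorem coeff_partialGF_le (K n : ℕ) :
    0 ≤ (partialGF K).coeff n ∧ (partialGF K).coeff n ≤ (partialGF (K + 1)).coeff n := by
  have h0 : ∀ K n, 0 ≤ (partialGF K).coeff n := by
    intro K
    induction K with
    | zero => intro n; simp only [partialGF, Finset.range_zero, Finset.prod_empty, coeff_one]; positivity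
    | succ K ih =>
      intro n
      rw [partialGF, Finset.prod_range_succ, ← partialGF, coeff_mul]
      refine Finset.sum_nonneg fun x _ => mul_nonneg (ih _) ?_
      rw [coeff_mk]; positivity
  refine ⟨h0 K n, ?_⟩
  rw [partialGF, partialGF, Finset.prod_range_succ, ← partialGF, coeff_mul]
  have := Finset.single_le_sum (f := fun p : ℕ × ℕ => (partialGF K).coeff p.1 *
      (PowerSeries.mk fun n => if (K + 1) ∣ n then (1 : ℤ) else 0).coeff p.2)
    (s := Finset.HasAntidiagonal.antidiagonal n)
        (fun x _ => mul_nonneg (h0 K _) (by rw [coeff_mk]; positivity))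
    (show (n, 0) ∈ Finset.HasAntidiagonal.antidiagonal n by simp)
  simpa using this

theorem coeff_partialGF_le_partitionFn (K n : ℕ) :
    (partialGF K).coeff n ≤ (partitionFn n : ℤ) :=
  (monotone_nat_of_le_succ fun K => (coeff_partialGF_le K n).2).ge_of_tendsto
    (tendsto_coeff_partialGF n) K

open PowerSeries in
theorem hasSum_partialGF (K : ℕ) {q : ℂ} (hq : ‖q‖ < 1) :
    Summable (fun n => ‖((partialGF K).coeff n : ℂ) * q ^ n‖) ∧
    ∑' n, ((partialGF K).coeff n : ℂ) * q ^ n = ∏ i ∈ Finset.range K, (1 - q ^ (i + 1))⁻¹ := by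
  induction K with
  | zero =>
    have : ∀ n, ((partialGF 0).coeff n : ℂ) * q ^ n = if n = 0 then 1 else 0 := by
      intro n
      simp only [partialGF, Finset.range_zero, Finset.prod_empty, coeff_one]
      split_ifs with h <;> simp [h]
    simp_rw [this]
    refine ⟨summable_of_ne_finset_zero (s := {0}) fun n hn => ?_, by simp⟩
    simp at hn; simp [hn]
  | succ K ih =>
    have hqK : ‖q ^ (K + 1)‖ < 1 := by
      rw [norm_pow]; exact pow_lt_one₀ (norm_nonneg _) hq (by omega)
    have hinj : Function.Injective fun j : ℕ => (K + 1) * j := fun a b h => by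
      simpa using h
    have hz : ∀ n ∉ Set.range (fun j : ℕ => (K + 1) * j),
        (((if (K + 1) ∣ n then (1 : ℤ) else 0 : ℤ)) : ℂ) * q ^ n = 0 := by
      intro n hn
      rw [if_neg fun ⟨c, hc⟩ => hn ⟨c, hc.symm⟩]; simp
    have hc : ((fun n : ℕ => (((if (K + 1) ∣ n then (1 : ℤ) else 0 : ℤ)) : ℂ) * q ^ n) ∘
        fun j : ℕ => (K + 1) * j) = fun j => (q ^ (K + 1)) ^ j := by
      funext j; simp [pow_mul]
    have hs : HasSum (fun n : ℕ => (((if (K + 1) ∣ n then (1 : ℤ) else 0 : ℤ)) : ℂ) * q ^ n)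
        (1 - q ^ (K + 1))⁻¹ := by
      rw [← hinj.hasSum_iff hz, hc]
      exact hasSum_geometric_of_norm_lt_one hqK
    obtain ⟨f, hf⟩ : ∃ f : ℕ → ℂ, ∀ n, f n = ((partialGF K).coeff n : ℂ) * q ^ n := ⟨_, fun _ => rfl⟩
    obtain ⟨g, hg⟩ : ∃ g : ℕ → ℂ, ∀ n, g n =
      (((if (K + 1) ∣ n then (1 : ℤ) else 0 : ℤ)) : ℂ) * q ^ n := ⟨_, fun _ => rfl⟩
    simp_rw [← hf] at ih
    simp_rw [← hg] at hs
    have hsn := hs.summable.norm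
    have hmul : ∀ n, ((partialGF (K + 1)).coeff n : ℂ) * q ^ n =
        ∑ x ∈ Finset.HasAntidiagonal.antidiagonal n, f x.1 * g x.2 := by
      intro n
      rw [partialGF, Finset.prod_range_succ, ← partialGF, coeff_mul, Int.cast_sum, Finset.sum_mul]
      refine Finset.sum_congr rfl fun x hx => ?_
      rw [hf, hg, coeff_mk, ← Finset.HasAntidiagonal.mem_antidiagonal.mp hx, pow_add]
      push_cast; ring
    simp_rw [hmul]
    refine ⟨summable_norm_sum_mul_antidiagonal_of_summable_norm ih.1 hsn, ?_⟩
    rw [← tsum_mul_tsum_eq_tsum_sum_antidiagonal_of_summable_norm ih.1 hsn, ih.2, hs.tsum_eq,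
      Finset.prod_range_succ]

theorem add_le_succ_mul_succ (i j : ℕ) : i + j ≤ (i + 1) * (j + 1) := by nlinarith

theorem summable_log_double {q : ℂ} (hq : ‖q‖ < 1) :
    Summable fun p : ℕ × ℕ => q ^ ((p.1 + 1) * (p.2 + 1)) / ((p.2 : ℂ) + 1) := by
  have hg := summable_geometric_of_lt_one (norm_nonneg q) hq
  have h := hg.mul_of_nonneg hg (fun n => by positivity) (fun n => by positivity)
  refine Summable.of_norm_bounded h fun p => ?_
  have h1 : (1 : ℝ) ≤ ‖(p.2 : ℂ) + 1‖ := by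
    have : (p.2 : ℂ) + 1 = ((p.2 + 1 : ℕ) : ℂ) := by push_cast; rfl
    rw [this, Complex.norm_natCast]; push_cast; linarith [Nat.cast_nonneg (α := ℝ) p.2]
  rw [norm_div, norm_pow, ← pow_add]
  refine (div_le_self (by positivity) h1).trans ?_
  exact pow_le_pow_of_le_one (norm_nonneg _) hq.le (add_le_succ_mul_succ _ _)

theorem exp_tsum_log {q : ℂ} (hq : ‖q‖ < 1) :
    Complex.exp (∑' j : ℕ, q ^ (j + 1) / ((j : ℂ) + 1)) = (1 - q)⁻¹ := by
  have h := (hasSum_nat_add_iff' 1).mpr (Complex.hasSum_taylorSeries_neg_log hq)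
  simp only [Finset.range_one, Finset.sum_singleton, pow_zero, Nat.cast_zero, div_zero, sub_zero,
    Nat.cast_add, Nat.cast_one] at h
  have hne : 1 - q ≠ 0 := by
    intro h0
    rw [sub_eq_zero] at h0
    rw [← h0] at hq; simp at hq
  rw [h.tsum_eq, Complex.exp_neg, Complex.exp_log hne]

open Filter Topology in
theorem tendsto_prod_exp {q : ℂ} (hq : ‖q‖ < 1) :
    Tendsto (fun K => ∏ i ∈ Finset.range K, (1 - q ^ (i + 1))⁻¹) atTop
      (𝓝 (Complex.exp (∑' p : ℕ × ℕ, q ^ ((p.1 + 1) * (p.2 + 1)) / ((p.2 : ℂ) + 1)))) := by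
  have hs := summable_log_double hq
  have h1 : ∀ i : ℕ, (1 - q ^ (i + 1))⁻¹ =
      Complex.exp (∑' j : ℕ, q ^ ((i + 1) * (j + 1)) / ((j : ℂ) + 1)) := by
    intro i
    rw [← exp_tsum_log (q := q ^ (i + 1))]
    · simp_rw [← pow_mul]
    · rw [norm_pow]; exact pow_lt_one₀ (norm_nonneg _) hq (by omega)
  simp_rw [h1, ← Complex.exp_sum]
  rw [hs.tsum_prod]
  exact (Complex.continuous_exp.tendsto _).comp hs.prod.hasSum.tendsto_sum_nat

open Filter Topology in
theorem sum_partitionFn_le {x : ℝ} (h0 : 0 ≤ x) (h1 : x < 1) (N : ℕ) :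
    ∑ n ∈ Finset.range N, (partitionFn n : ℝ) * x ^ n ≤
      ‖Complex.exp (∑' p : ℕ × ℕ, (x : ℂ) ^ ((p.1 + 1) * (p.2 + 1)) / ((p.2 : ℂ) + 1))‖ := by
  have hx : ‖(x : ℂ)‖ < 1 := by rw [Complex.norm_real, Real.norm_of_nonneg h0]; exact h1
  have ht : Tendsto (fun K => ∑ n ∈ Finset.range N, ((partialGF K).coeff n : ℝ) * x ^ n) atTop
      (𝓝 (∑ n ∈ Finset.range N, (partitionFn n : ℝ) * x ^ n)) := by
    refine tendsto_finsetSum _ fun n _ => Tendsto.mul_const _ ?_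
    have := tendsto_coeff_partialGF n
    rw [nhds_discrete, tendsto_pure] at this
    refine tendsto_const_nhds.congr' (this.mono fun K hK => ?_)
    simp [hK]
  refine le_of_tendsto_of_tendsto' ht (tendsto_prod_exp hx).norm fun K => ?_
  obtain ⟨hs, ht⟩ := hasSum_partialGF K hx
  rw [← ht]
  have hc : ∀ n, ((partialGF K).coeff n : ℂ) * (x : ℂ) ^ n =
      ((((partialGF K).coeff n : ℝ) * x ^ n : ℝ) : ℂ) := by intro n; push_cast; rfl
  have hnn : ∀ n, 0 ≤ ((partialGF K).coeff n : ℝ) * x ^ n := fun n =>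
    mul_nonneg (by exact_mod_cast (coeff_partialGF_le K n).1) (by positivity)
  simp_rw [hc] at hs ⊢
  rw [← Complex.ofReal_tsum, Complex.norm_real, Real.norm_of_nonneg (tsum_nonneg hnn)]
  refine Summable.sum_le_tsum _ (fun n _ => hnn n) ?_
  simpa only [Complex.norm_real, Real.norm_of_nonneg (hnn _)] using hs

theorem summable_partitionFn {x : ℝ} (h0 : 0 ≤ x) (h1 : x < 1) :
    Summable fun n => (partitionFn n : ℝ) * x ^ n :=
  summable_of_sum_range_le (fun n => by positivity) (sum_partitionFn_le h0 h1)

open Filter Topology in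
theorem hasSum_partitionFn {q : ℂ} (hq : ‖q‖ < 1) :
    HasSum (fun n => (partitionFn n : ℂ) * q ^ n)
      (Complex.exp (∑' p : ℕ × ℕ, q ^ ((p.1 + 1) * (p.2 + 1)) / ((p.2 : ℂ) + 1))) := by
  have hs := summable_partitionFn (norm_nonneg q) hq
  have hsc : Summable fun n => (partitionFn n : ℂ) * q ^ n :=
    Summable.of_norm_bounded hs fun n => by simp
  have ht : Tendsto (fun K => ∑' n, ((partialGF K).coeff n : ℂ) * q ^ n) atTop
      (𝓝 (∑' n, (partitionFn n : ℂ) * q ^ n)) := by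
    refine tendsto_tsum_of_dominated_convergence hs (fun n => ?_) (.of_forall fun K n => ?_)
    · have := tendsto_coeff_partialGF n
      rw [nhds_discrete, tendsto_pure] at this
      refine tendsto_const_nhds.congr' (this.mono fun K hK => ?_)
      simp [hK]
    · rw [norm_mul, norm_pow, Complex.norm_intCast]
      gcongr
      rw [abs_of_nonneg (by exact_mod_cast (coeff_partialGF_le K n).1)]
      exact_mod_cast coeff_partialGF_le_partitionFn K n
  simp_rw [(hasSum_partialGF _ hq).2] at ht
  rw [tendsto_nhds_unique (tendsto_prod_exp hq) ht]
  exact hsc.hasSum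

/-- The coefficients of `∏ (1 - q ^ k)⁻¹` over `k ≥ 2`. -/
def noOnes (n : ℕ) : ℤ := Nat.casesOn n 1 dP

theorem hasSum_noOnes {q : ℂ} (hq : ‖q‖ < 1) :
    HasSum (fun n => (noOnes n : ℂ) * q ^ n)
      (Complex.exp (∑' p : ℕ × ℕ, q ^ ((p.1 + 2) * (p.2 + 1)) / ((p.2 : ℂ) + 1))) := by
  have hF := hasSum_partitionFn hq
  have hs := summable_log_double hq
  have hp0 : partitionFn 0 = 1 := by simp [partitionFn]
  have hval : Complex.exp (∑' p : ℕ × ℕ, q ^ ((p.1 + 2) * (p.2 + 1)) / ((p.2 : ℂ) + 1)) =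
      (1 - q) * Complex.exp (∑' p : ℕ × ℕ, q ^ ((p.1 + 1) * (p.2 + 1)) / ((p.2 : ℂ) + 1)) := by
    have hs' : Summable fun p : ℕ × ℕ => q ^ ((p.1 + 2) * (p.2 + 1)) / ((p.2 : ℂ) + 1) :=
      hs.comp_injective (i := fun p : ℕ × ℕ => (p.1 + 1, p.2)) fun a b h => by
        simp only [Prod.mk.injEq, add_left_inj] at h; exact Prod.ext h.1 h.2
    have hne : 1 - q ≠ 0 := by
      intro h0
      rw [sub_eq_zero] at h0
      rw [← h0] at hq; simp at hq
    rw [hs.tsum_prod, hs'.tsum_prod, hs.prod.tsum_eq_zero_add, Complex.exp_add]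
    simp only [zero_add, one_mul, exp_tsum_log hq]
    rw [mul_inv_cancel_left₀ hne]
  rw [hval, ← hasSum_nat_add_iff' 1]
  have hF1 := (hasSum_nat_add_iff' 1).mpr hF
  have := hF1.sub (hF.mul_left q)
  convert this using 1
  · funext n
    simp only [noOnes, dP]; push_cast; ring
  · simp [noOnes, hp0]; ring

theorem hasSum_of_forall_eq {ι : Type*} {f g : ι → ℝ} {a b : ℝ} (h : HasSum f a)
    (hfg : ∀ i, g i = f i) (hab : b = a) : HasSum g b := by
  rw [hab, funext hfg]; exact h

theorem four_mul_le_three_pow (n : ℕ) :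
    4 * ((2 * n + 3) * (2 * n + 2) * (2 * n + 1)) + 3 ≤ 3 ^ (2 * n + 3) := by
  induction n with
  | zero => norm_num
  | succ n ih =>
    rw [show 2 * (n + 1) + 3 = 2 * n + 3 + 2 by ring, pow_add]
    nlinarith [Nat.zero_le (n ^ 3), Nat.zero_le (n ^ 2), Nat.zero_le n]

theorem cosh_mul_cube_le {y : ℝ} (hy : 0 ≤ y) : Real.cosh y * y ^ 3 ≤ Real.sinh y ^ 3 := by
  have h3 : Real.sinh y ^ 3 = (Real.sinh (3 * y) - 3 * Real.sinh y) / 4 := by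
    rw [Real.sinh_three_mul]; ring
  have hc := (Real.hasSum_cosh y).mul_right (y ^ 3)
  have hs := (((Real.hasSum_sinh (3 * y)).sub ((Real.hasSum_sinh y).mul_left 3)).div_const 4)
  have hs' := (hasSum_nat_add_iff' 1).mpr hs
  simp only [Finset.range_one, Finset.sum_singleton, mul_zero, zero_add, pow_one,
    Nat.factorial_one, Nat.cast_one, div_one, sub_self, zero_div, sub_zero] at hs'
  rw [h3]
  refine hasSum_le (fun n => ?_) hc hs'
  have hf : ((2 * (n + 1) + 1).factorial : ℝ) =
      (2 * n + 3) * (2 * n + 2) * (2 * n + 1) * (2 * n).factorial := by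
    rw [show 2 * (n + 1) + 1 = 2 * n + 1 + 1 + 1 by ring, Nat.factorial_succ, Nat.factorial_succ,
      Nat.factorial_succ]
    push_cast; ring
  have hk : 4 * ((2 * (n : ℝ) + 3) * (2 * n + 2) * (2 * n + 1)) + 3 ≤ 3 ^ (2 * n + 3) := by
    exact_mod_cast four_mul_le_three_pow n
  have hpos : (0 : ℝ) < (2 * n).factorial := by positivity
  rw [hf, show 2 * (n + 1) + 1 = 2 * n + 3 by ring]
  calc y ^ (2 * n) / (2 * n).factorial * y ^ 3
      = (4 * ((2 * (n : ℝ) + 3) * (2 * n + 2) * (2 * n + 1)) + 3 - 3) * y ^ (2 * n + 3) /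
        ((2 * n + 3) * (2 * n + 2) * (2 * n + 1) * (2 * n).factorial) / 4 := by
        rw [pow_add]; field_simp; ring
    _ ≤ (3 ^ (2 * n + 3) - 3) * y ^ (2 * n + 3) /
        ((2 * n + 3) * (2 * n + 2) * (2 * n + 1) * (2 * n).factorial) / 4 := by gcongr
    _ = _ := by rw [mul_pow]; ring

theorem hasSum_mul_pow {x : ℝ} (h0 : 0 ≤ x) (h1 : x < 1) :
    HasSum (fun i : ℕ => ((i : ℝ) + 1) * x ^ (i + 1)) (x / (1 - x) ^ 2) := by
  have hx : ‖x‖ < 1 := by rwa [Real.norm_of_nonneg h0]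
  have h := (hasSum_choose_mul_geometric_of_norm_lt_one 1 hx).mul_left x
  refine hasSum_of_forall_eq h ?_ ?_
  · intro i; simp; ring
  · ring

theorem cast_choose_two (i : ℕ) : (((i + 2).choose 2 : ℕ) : ℝ) = (i + 2) * (i + 1) / 2 := by
  rw [Nat.cast_choose_two]; push_cast; ring

theorem cast_choose_three (i : ℕ) :
    (((i + 3).choose 3 : ℕ) : ℝ) = (i + 3) * (i + 2) * (i + 1) / 6 := by
  have := Nat.add_one_mul_choose_eq (i + 2) 2
  have h : (((i + 2 + 1) * (i + 2).choose 2 : ℕ) : ℝ) = (((i + 2 + 1).choose 3 * 3 : ℕ) : ℝ) := by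
    exact_mod_cast this
  push_cast at h
  rw [cast_choose_two] at h
  linarith

theorem hasSum_sq_mul_pow {x : ℝ} (h0 : 0 ≤ x) (h1 : x < 1) :
    HasSum (fun i : ℕ => ((i : ℝ) + 1) ^ 2 * x ^ (i + 1)) (x * (1 + x) / (1 - x) ^ 3) := by
  have hx : ‖x‖ < 1 := by rwa [Real.norm_of_nonneg h0]
  have h := (((hasSum_choose_mul_geometric_of_norm_lt_one 2 hx).mul_left 2).sub
    (hasSum_choose_mul_geometric_of_norm_lt_one 1 hx)).mul_left x
  have : 1 - x ≠ 0 := by linarith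
  refine hasSum_of_forall_eq h ?_ ?_
  · intro i; rw [cast_choose_two]; simp; ring
  · field_simp; ring

theorem hasSum_cube_mul_pow {x : ℝ} (h0 : 0 ≤ x) (h1 : x < 1) :
    HasSum (fun i : ℕ => ((i : ℝ) + 1) ^ 3 * x ^ (i + 1))
      (6 * (x / (1 - x) ^ 2) ^ 2 + x / (1 - x) ^ 2) := by
  have hx : ‖x‖ < 1 := by rwa [Real.norm_of_nonneg h0]
  have h := ((((hasSum_choose_mul_geometric_of_norm_lt_one 3 hx).mul_left 6).sub
    ((hasSum_choose_mul_geometric_of_norm_lt_one 2 hx).mul_left 6)).add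
    (hasSum_choose_mul_geometric_of_norm_lt_one 1 hx)).mul_left x
  have : 1 - x ≠ 0 := by linarith
  refine hasSum_of_forall_eq h ?_ ?_
  · intro i; rw [cast_choose_two, cast_choose_three]; simp; ring
  · field_simp; ring

theorem exp_neg_lt_one {s : ℝ} (hs : 0 < s) : Real.exp (-s) < 1 := by simpa using hs

theorem exp_div_one_sub_sq_le {s : ℝ} (hs : 0 < s) :
    Real.exp (-s) / (1 - Real.exp (-s)) ^ 2 ≤ 1 / s ^ 2 := by
  have h1 := exp_neg_lt_one hs
  have h2 : s / 2 ≤ Real.sinh (s / 2) := Real.self_le_sinh_iff.mpr (by positivity)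
  have he : Real.exp (-s) = Real.exp (-(s / 2)) ^ 2 := by rw [← Real.exp_nat_mul]; congr 1; push_cast; ring
  have hd : 1 - Real.exp (-s) = 2 * Real.exp (-(s / 2)) * Real.sinh (s / 2) := by
    rw [Real.sinh_eq, he]
    have : Real.exp (s / 2) * Real.exp (-(s / 2)) = 1 := by rw [← Real.exp_add]; simp
    linear_combination (-1) * this
  have hE := Real.exp_pos (-(s / 2))
  rw [hd, he, div_le_div_iff₀ (by have := h2; positivity) (by positivity)]
  have : s ≤ 2 * Real.sinh (s / 2) := by linarith
  calc _ = Real.exp (-(s / 2)) ^ 2 * s ^ 2 := by ring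
    _ ≤ Real.exp (-(s / 2)) ^ 2 * (2 * Real.sinh (s / 2)) ^ 2 := by gcongr
    _ = _ := by ring

theorem exp_mul_div_one_sub_cube_le {s : ℝ} (hs : 0 < s) :
    Real.exp (-s) * (1 + Real.exp (-s)) / (1 - Real.exp (-s)) ^ 3 ≤ 2 / s ^ 3 := by
  have h1 := exp_neg_lt_one hs
  have h2 : s / 2 ≤ Real.sinh (s / 2) := Real.self_le_sinh_iff.mpr (by positivity)
  have hc := cosh_mul_cube_le (y := s / 2) (by positivity)
  have he : Real.exp (-s) = Real.exp (-(s / 2)) ^ 2 := by rw [← Real.exp_nat_mul]; congr 1; push_cast; ring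
  have hm : Real.exp (s / 2) * Real.exp (-(s / 2)) = 1 := by rw [← Real.exp_add]; simp
  have hd : 1 - Real.exp (-s) = 2 * Real.exp (-(s / 2)) * Real.sinh (s / 2) := by
    rw [Real.sinh_eq, he]
    linear_combination (-1) * hm
  have hd' : 1 + Real.exp (-s) = 2 * Real.exp (-(s / 2)) * Real.cosh (s / 2) := by
    rw [Real.cosh_eq, he]
    linear_combination (-1) * hm
  have hE := Real.exp_pos (-(s / 2))
  rw [hd, hd', he, div_le_div_iff₀ (by have := h2; positivity) (by positivity)]
  calc _ = 16 * Real.exp (-(s / 2)) ^ 3 * (Real.cosh (s / 2) * (s / 2) ^ 3) := by ring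
    _ ≤ 16 * Real.exp (-(s / 2)) ^ 3 * Real.sinh (s / 2) ^ 3 := by gcongr
    _ = _ := by ring

theorem exp_div_one_sub_le {s : ℝ} (hs : 0 < s) :
    Real.exp (-s) / (1 - Real.exp (-s)) ≤ 1 / s := by
  have h1 := exp_neg_lt_one hs
  rw [div_le_div_iff₀ (by linarith) hs]
  have := Real.add_one_le_exp s
  have hm : Real.exp s * Real.exp (-s) = 1 := by rw [← Real.exp_add]; simp
  nlinarith [Real.exp_pos (-s)]

/-! ### Moments of the logarithm of the generating function -/

/-- The exponent `(i + 2) * (j + 1)` indexed by a part `i + 2` and a multiplicity `j + 1`. -/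
def freq (p : ℕ × ℕ) : ℝ := ((p.1 : ℝ) + 2) * ((p.2 : ℝ) + 1)

theorem summable_moment {t : ℝ} (ht : 0 < t) (r : ℕ) : Summable fun p : ℕ × ℕ =>
    (((p.1 : ℝ) + 1) * ((p.2 : ℝ) + 1)) ^ r * Real.exp (-(((p.1 : ℝ) + 1) * ((p.2 : ℝ) + 1) * t)) := by
  have h1 : Real.exp (-(t / 2)) < 1 := exp_neg_lt_one (by positivity)
  have hg := summable_geometric_of_lt_one (Real.exp_pos _).le h1
  have h := (hg.mul_of_nonneg hg (fun n => by positivity) (fun n => by positivity)).mul_left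
    (r.factorial * (2 / t) ^ r)
  refine Summable.of_nonneg_of_le (fun p => by positivity) (fun p => ?_) h
  set y : ℝ := ((p.1 : ℝ) + 1) * ((p.2 : ℝ) + 1) with hy
  have hy0 : 0 ≤ y := by positivity
  have hle : (p.1 : ℝ) + p.2 ≤ y := by
    rw [hy]; nlinarith [mul_nonneg (Nat.cast_nonneg (α := ℝ) p.1) (Nat.cast_nonneg (α := ℝ) p.2)]
  have h2 := Real.pow_div_factorial_le_exp (y * (t / 2)) (by positivity) r
  rw [div_le_iff₀ (by positivity)] at h2
  have h3 : y ^ r ≤ r.factorial * (2 / t) ^ r * Real.exp (y * (t / 2)) := by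
    calc y ^ r = (2 / t) ^ r * (y * (t / 2)) ^ r := by rw [← mul_pow]; congr 1; field_simp
      _ ≤ (2 / t) ^ r * (Real.exp (y * (t / 2)) * r.factorial) := by gcongr
      _ = _ := by ring
  calc y ^ r * Real.exp (-(y * t))
      ≤ r.factorial * (2 / t) ^ r * Real.exp (y * (t / 2)) * Real.exp (-(y * t)) := by gcongr
    _ = r.factorial * (2 / t) ^ r * Real.exp (-(y * (t / 2))) := by
        rw [mul_assoc, ← Real.exp_add]; congr 2; ring
    _ ≤ r.factorial * (2 / t) ^ r * (Real.exp (-(t / 2)) ^ p.1 * Real.exp (-(t / 2)) ^ p.2) := by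
        rw [← Real.exp_nat_mul, ← Real.exp_nat_mul, ← Real.exp_add]
        gcongr
        nlinarith

theorem tsum_pair_le {h : ℕ × ℕ → ℝ} (hs : Summable h) {c : ℕ → ℝ} {C : ℝ} (hc : HasSum c C)
    (hle : ∀ j, ∑' i, h (i, j) ≤ c j) : ∑' p, h p ≤ C := by
  have hs' : Summable fun p => h (Equiv.prodComm ℕ ℕ p) := (Equiv.prodComm ℕ ℕ).summable_iff.mpr hs
  rw [← (Equiv.prodComm ℕ ℕ).tsum_eq h, hs'.tsum_prod]
  rw [← hc.tsum_eq]
  exact Summable.tsum_le_tsum hle hs'.prod hc.summable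

theorem hasSum_zeta_two_shift : HasSum (fun j : ℕ => 1 / ((j : ℝ) + 1) ^ 2) (Real.pi ^ 2 / 6) := by
  have h := (hasSum_nat_add_iff' 1).mpr hasSum_zeta_two
  simpa using h

theorem exp_neg_mul_eq (i j : ℕ) (t : ℝ) : Real.exp (-(((i : ℝ) + 1) * ((j : ℝ) + 1) * t)) =
    Real.exp (-(((j : ℝ) + 1) * t)) ^ (i + 1) := by
  rw [← Real.exp_nat_mul]; congr 1; push_cast; ring

theorem moment_zero_le {t : ℝ} (ht : 0 < t) :
    ∑' p : ℕ × ℕ, Real.exp (-(((p.1 : ℝ) + 1) * ((p.2 : ℝ) + 1) * t)) / ((p.2 : ℝ) + 1) ≤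
      Real.pi ^ 2 / 6 / t := by
  refine tsum_pair_le (Summable.of_nonneg_of_le (fun p => by positivity) (fun p => ?_)
    (summable_moment ht 0)) (hasSum_zeta_two_shift.div_const t) fun j => ?_
  · rw [pow_zero, one_mul]
    exact div_le_self (by positivity) (by linarith [Nat.cast_nonneg (α := ℝ) p.2])
  · have hs : 0 < ((j : ℝ) + 1) * t := by positivity
    have h1 := exp_neg_lt_one hs
    have h2 := exp_div_one_sub_le hs
    have h := (hasSum_geometric_of_lt_one (Real.exp_pos (-(((j : ℝ) + 1) * t))).le h1).mul_left
      (Real.exp (-(((j : ℝ) + 1) * t)))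
    simp_rw [exp_neg_mul_eq, tsum_div_const, pow_succ']
    rw [h.tsum_eq]
    calc _ ≤ 1 / (((j : ℝ) + 1) * t) / ((j : ℝ) + 1) := by
          rw [← div_eq_mul_inv]; gcongr
      _ = _ := by field_simp

theorem summable_moment_of_le {t : ℝ} (ht : 0 < t) (r : ℕ) {a b : ℕ} (ha : a ≤ r) (hb : b ≤ r) :
    Summable fun p : ℕ × ℕ => ((p.2 : ℝ) + 1) ^ b *
      (((p.1 : ℝ) + 1) ^ a * Real.exp (-(((p.1 : ℝ) + 1) * ((p.2 : ℝ) + 1) * t))) := by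
  refine Summable.of_nonneg_of_le (fun p => by positivity) (fun p => ?_) (summable_moment ht r)
  rw [mul_pow, ← mul_assoc, mul_comm (_ ^ b)]
  gcongr <;> linarith [Nat.cast_nonneg (α := ℝ) p.1, Nat.cast_nonneg (α := ℝ) p.2]

theorem moment_one_le {t : ℝ} (ht : 0 < t) :
    ∑' p : ℕ × ℕ, ((p.1 : ℝ) + 1) * Real.exp (-(((p.1 : ℝ) + 1) * ((p.2 : ℝ) + 1) * t)) ≤
      Real.pi ^ 2 / 6 / t ^ 2 := by
  have hsum := summable_moment_of_le ht 1 (a := 1) (b := 0) le_rfl (by norm_num)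
  simp only [pow_zero, pow_one, one_mul] at hsum
  refine tsum_pair_le hsum (hasSum_zeta_two_shift.div_const (t ^ 2)) fun j => ?_
  have hs : 0 < ((j : ℝ) + 1) * t := by positivity
  simp_rw [exp_neg_mul_eq]
  rw [(hasSum_mul_pow (Real.exp_pos _).le (exp_neg_lt_one hs)).tsum_eq]
  refine (exp_div_one_sub_sq_le hs).trans_eq ?_
  field_simp

theorem moment_two_le {t : ℝ} (ht : 0 < t) :
    ∑' p : ℕ × ℕ, ((p.2 : ℝ) + 1) ^ 1 *
      (((p.1 : ℝ) + 1) ^ 2 * Real.exp (-(((p.1 : ℝ) + 1) * ((p.2 : ℝ) + 1) * t))) ≤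
      Real.pi ^ 2 / 6 * (2 / t ^ 3) := by
  refine tsum_pair_le (summable_moment_of_le ht 2 le_rfl (by norm_num))
    (hasSum_zeta_two_shift.mul_right (2 / t ^ 3)) fun j => ?_
  have hs : 0 < ((j : ℝ) + 1) * t := by positivity
  simp_rw [exp_neg_mul_eq]
  rw [tsum_mul_left, (hasSum_sq_mul_pow (Real.exp_pos _).le (exp_neg_lt_one hs)).tsum_eq]
  calc _ ≤ ((j : ℝ) + 1) ^ 1 * (2 / (((j : ℝ) + 1) * t) ^ 3) := by
        exact mul_le_mul_of_nonneg_left (exp_mul_div_one_sub_cube_le hs) (by positivity)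
    _ = _ := by field_simp

theorem moment_three_le {t : ℝ} (ht : 0 < t) :
    ∑' p : ℕ × ℕ, ((p.2 : ℝ) + 1) ^ 2 *
      (((p.1 : ℝ) + 1) ^ 3 * Real.exp (-(((p.1 : ℝ) + 1) * ((p.2 : ℝ) + 1) * t))) ≤
      Real.pi ^ 2 / 6 * (6 / t ^ 4) + Real.pi ^ 2 / 6 * (2 / t ^ 3) := by
  have hs3 := summable_moment_of_le ht 3 (a := 3) (b := 2) le_rfl (by norm_num)
  have hs1 := summable_moment_of_le ht 2 (a := 1) (b := 2) (by norm_num) le_rfl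
  have hswap : ∑' p : ℕ × ℕ, ((p.2 : ℝ) + 1) ^ 2 *
      (((p.1 : ℝ) + 1) ^ 1 * Real.exp (-(((p.1 : ℝ) + 1) * ((p.2 : ℝ) + 1) * t))) ≤
      Real.pi ^ 2 / 6 * (2 / t ^ 3) := by
    refine (Eq.trans_le ?_ (moment_two_le ht))
    rw [← (Equiv.prodComm ℕ ℕ).tsum_eq]
    refine tsum_congr fun p => ?_
    simp only [Equiv.prodComm_apply, Prod.fst_swap, Prod.snd_swap]
    rw [mul_comm ((p.2 : ℝ) + 1) ((p.1 : ℝ) + 1)]; ring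
  have hdiff := tsum_pair_le (hs3.sub hs1)
    (hasSum_zeta_two_shift.mul_right (6 / t ^ 4)) fun j => ?_
  · rw [hs3.tsum_sub hs1] at hdiff
    linarith
  · have hs : 0 < ((j : ℝ) + 1) * t := by positivity
    have h3 := (hasSum_cube_mul_pow (Real.exp_pos _).le (exp_neg_lt_one hs)).mul_left
      (((j : ℝ) + 1) ^ 2)
    have h1 := (hasSum_mul_pow (Real.exp_pos _).le (exp_neg_lt_one hs)).mul_left
      (((j : ℝ) + 1) ^ 2)
    simp_rw [exp_neg_mul_eq, pow_one]
    rw [(h3.sub h1).tsum_eq]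
    have hP := exp_div_one_sub_sq_le hs
    have hP0 : 0 ≤ Real.exp (-(((j : ℝ) + 1) * t)) / (1 - Real.exp (-(((j : ℝ) + 1) * t))) ^ 2 := by
      positivity
    calc _ = ((j : ℝ) + 1) ^ 2 * (6 * (Real.exp (-(((j : ℝ) + 1) * t)) /
          (1 - Real.exp (-(((j : ℝ) + 1) * t))) ^ 2) ^ 2) := by ring
      _ ≤ ((j : ℝ) + 1) ^ 2 * (6 * (1 / (((j : ℝ) + 1) * t) ^ 2) ^ 2) := by gcongr
      _ = _ := by field_simp

theorem pi_sq_div_six_lt : Real.pi ^ 2 / 6 < 1.645 := by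
  have h := Real.pi_lt_d6
  have h0 := Real.pi_pos
  nlinarith

theorem partitionFn_lt {n : ℕ} (hn : n < 16690) : partitionFn n < 2 ^ 512 := by
  set t : ℝ := 1 / 100 with ht
  have ht0 : 0 < t := by norm_num [ht]
  have h := sum_partitionFn_le (Real.exp_pos (-t)).le (exp_neg_lt_one ht0) (n + 1)
  have h1 := Finset.single_le_sum (f := fun i => (partitionFn i : ℝ) * Real.exp (-t) ^ i)
    (fun i _ => by positivity) (Finset.self_mem_range_succ n)
  have hterm : ∀ p : ℕ × ℕ, ((Real.exp (-t) : ℝ) : ℂ) ^ ((p.1 + 1) * (p.2 + 1)) / ((p.2 : ℂ) + 1) =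
      ((Real.exp (-(((p.1 : ℝ) + 1) * ((p.2 : ℝ) + 1) * t)) / ((p.2 : ℝ) + 1) : ℝ) : ℂ) := by
    intro p
    rw [← Complex.ofReal_pow, ← Real.exp_nat_mul,
      show (((p.1 + 1) * (p.2 + 1) : ℕ) : ℝ) * -t = -(((p.1 : ℝ) + 1) * ((p.2 : ℝ) + 1) * t) by
        push_cast; ring]
    push_cast; rfl
  simp_rw [hterm] at h
  rw [← Complex.ofReal_tsum, ← Complex.ofReal_exp, Complex.norm_real,
    Real.norm_of_nonneg (Real.exp_pos _).le] at h
  have h2 := (h1.trans h).trans (Real.exp_le_exp.mpr (moment_zero_le ht0))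
  simp only [← Real.exp_nat_mul] at h2
  have hm : Real.exp (n * -t) * Real.exp (n * t) = 1 := by rw [← Real.exp_add]; simp
  have h3 : (partitionFn n : ℝ) ≤ Real.exp (Real.pi ^ 2 / 6 / t + n * t) := by
    rw [Real.exp_add]
    calc (partitionFn n : ℝ) = partitionFn n * Real.exp (n * -t) * Real.exp (n * t) := by
          rw [mul_assoc, hm, mul_one]
      _ ≤ _ := by gcongr
  have h4 : Real.exp (Real.pi ^ 2 / 6 / t + n * t) < 2 ^ 512 := by
    rw [← Real.lt_log_iff_exp_lt (by positivity), Real.log_pow]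
    have h5 := pi_sq_div_six_lt
    have h6 := Real.log_two_gt_d9
    have h7 : (n : ℝ) ≤ 16690 := by exact_mod_cast hn.le
    have h8 : Real.pi ^ 2 / 6 / t + n * t ≤ 1.645 * 100 + 16690 / 100 := by
      rw [ht, div_div_eq_mul_div, div_one]
      linarith
    push_cast
    linarith
  have h8 := h3.trans_lt h4
  exact_mod_cast h8

theorem laguerre2_dP_small {n : ℕ} (h1 : 301 ≤ n) (h2 : n < 16685) :
    3 * (dP (n + 2)) ^ 2 - 4 * dP (n + 1) * dP (n + 3) + dP n * dP (n + 4) > 0 :=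
  laguerre2_dP_of_lt (fun _ hi => partitionFn_lt hi) h1 h2

/-- The Boltzmann weight of `p` at inverse temperature `t`. -/
noncomputable def weight (t : ℝ) (p : ℕ × ℕ) : ℝ := Real.exp (-(freq p * t)) / ((p.2 : ℝ) + 1)

theorem freq_pos (p : ℕ × ℕ) : 0 < freq p := by unfold freq; positivity

theorem weight_pos (t : ℝ) (p : ℕ × ℕ) : 0 < weight t p := by unfold weight; positivity

theorem injective_shift : Function.Injective fun p : ℕ × ℕ => (p.1 + 1, p.2) := fun a b h => by
  simp only [Prod.mk.injEq, add_left_inj] at h; exact Prod.ext h.1 h.2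

theorem freq_eq_shift (p : ℕ × ℕ) :
    freq p = (((p.1 + 1 : ℕ) : ℝ) + 1) * ((p.2 : ℝ) + 1) := by
  unfold freq; push_cast; ring

theorem summable_weight_mul {t : ℝ} (ht : 0 < t) (r : ℕ) :
    Summable fun p => weight t p * freq p ^ r := by
  refine Summable.of_nonneg_of_le (fun p => mul_nonneg (weight_pos t p).le (pow_pos (freq_pos p) r).le)
    (fun p => ?_) ((summable_moment ht r).comp_injective injective_shift)
  simp only [Function.comp, ← freq_eq_shift, weight]
  rw [mul_comm]
  have := freq_pos p
  gcongr
  exact div_le_self (by positivity) (by linarith [Nat.cast_nonneg (α := ℝ) p.2])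

theorem cumulant_one_le {t : ℝ} (ht : 0 < t) :
    ∑' p, weight t p * freq p ≤ Real.pi ^ 2 / 6 / t ^ 2 := by
  have hs := summable_moment_of_le ht 1 (a := 1) (b := 0) le_rfl (by norm_num)
  simp only [pow_zero, pow_one, one_mul] at hs
  refine le_trans (Eq.trans_le ?_ (tsum_comp_le_tsum_of_inj hs (fun p => by positivity)
    injective_shift)) (moment_one_le ht)
  refine tsum_congr fun p => ?_
  simp only [Function.comp, ← freq_eq_shift, weight]
  have : (0 : ℝ) < p.2 + 1 := by positivity
  rw [freq_eq_shift]; field_simp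

theorem cumulant_two_le {t : ℝ} (ht : 0 < t) :
    ∑' p, weight t p * freq p ^ 2 ≤ Real.pi ^ 2 / 6 * (2 / t ^ 3) := by
  have hs := summable_moment_of_le ht 2 (a := 2) (b := 1) le_rfl (by norm_num)
  refine le_trans (Eq.trans_le ?_ (tsum_comp_le_tsum_of_inj hs (fun p => by positivity)
    injective_shift)) (moment_two_le ht)
  refine tsum_congr fun p => ?_
  simp only [Function.comp, ← freq_eq_shift, weight]
  have : (0 : ℝ) < p.2 + 1 := by positivity
  rw [freq_eq_shift]; field_simp

theorem cumulant_three_le {t : ℝ} (ht : 0 < t) :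
    ∑' p, weight t p * freq p ^ 3 ≤
      Real.pi ^ 2 / 6 * (6 / t ^ 4) + Real.pi ^ 2 / 6 * (2 / t ^ 3) := by
  have hs := summable_moment_of_le ht 3 (a := 3) (b := 2) le_rfl (by norm_num)
  refine le_trans (Eq.trans_le ?_ (tsum_comp_le_tsum_of_inj hs (fun p => by positivity)
    injective_shift)) (moment_three_le ht)
  refine tsum_congr fun p => ?_
  simp only [Function.comp, ← freq_eq_shift, weight]
  have : (0 : ℝ) < p.2 + 1 := by positivity
  rw [freq_eq_shift]; field_simp

theorem continuousOn_cumulant_one {a : ℝ} (ha : 0 < a) :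
    ContinuousOn (fun t => ∑' p, weight t p * freq p) (Set.Ici a) := by
  have hs := summable_weight_mul ha 1
  simp only [pow_one] at hs
  refine continuousOn_tsum (fun p => ?_) hs fun p t ht => ?_
  · unfold weight; fun_prop
  · have h1 := freq_pos p
    have h2 := weight_pos t p
    rw [Real.norm_of_nonneg (by positivity)]
    unfold weight
    have : a ≤ t := ht
    gcongr

theorem exists_saddle {M : ℕ} (hM : 16450 ≤ M) :
    ∃ t : ℝ, 0 < t ∧ t ≤ 1 / 100 ∧ ∑' p, weight t p * freq p = M := by
  have hM' : (16450 : ℝ) ≤ M := by exact_mod_cast hM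
  set a : ℝ := 1 / (3 * M) with ha
  have ha0 : 0 < a := by positivity
  have hab : a ≤ 1 / 100 := by
    rw [ha]; exact one_div_le_one_div_of_le (by norm_num) (by linarith)
  have hup : ∑' p, weight (1 / 100) p * freq p ≤ M := by
    refine (cumulant_one_le (by norm_num)).trans ?_
    have := pi_sq_div_six_lt
    norm_num at this ⊢
    linarith
  have hlow : (M : ℝ) ≤ ∑' p, weight a p * freq p := by
    have hs := summable_weight_mul ha0 1
    simp only [pow_one] at hs
    refine le_trans ?_ (hs.le_tsum (3 * M - 2, 0) fun p _ =>
      mul_nonneg (weight_pos a p).le (freq_pos p).le)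
    have hf : freq (3 * M - 2, 0) = 3 * M := by
      unfold freq
      have : ((3 * M - 2 : ℕ) : ℝ) = 3 * M - 2 := by
        rw [Nat.cast_sub (by omega)]; push_cast; ring
      simp only [this]; push_cast; ring
    have h1 : 3 * (M : ℝ) * a = 1 := by rw [ha]; field_simp
    have he : (1 : ℝ) / 3 ≤ Real.exp (-1) := by
      rw [Real.exp_neg, ← one_div]
      exact one_div_le_one_div_of_le (Real.exp_pos 1) (by linarith [Real.exp_one_lt_d9])
    simp only [weight, hf, h1]
    push_cast
    nlinarith
  obtain ⟨t, ht, hMt⟩ := intermediate_value_Icc' hab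
    ((continuousOn_cumulant_one ha0).mono Set.Icc_subset_Ici_self) ⟨hup, hlow⟩
  exact ⟨t, ha0.trans_le ht.1, ht.2, hMt⟩

/-- The logarithmic decay of the tilted generating function at angle `θ`. -/
noncomputable def decay (t θ : ℝ) : ℝ := ∑' p, weight t p * (1 - Real.cos (freq p * θ))

/-- The phase of the tilted generating function at angle `θ`, after removing its linear part. -/
noncomputable def phase (t θ : ℝ) : ℝ := ∑' p, weight t p * (Real.sin (freq p * θ) - freq p * θ)

/-- The characteristic function of the tilted generating function, centred at the saddle point. -/
noncomputable def charFn (t θ : ℝ) : ℂ := Complex.exp (-(decay t θ : ℂ) + phase t θ * Complex.I)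

theorem sub_sin_le {x : ℝ} : |Real.sin x - x| ≤ |x| ^ 3 / 6 := by
  wlog hx : 0 ≤ x generalizing x
  · have := this (x := -x) (by linarith)
    rw [Real.sin_neg, abs_neg] at this
    rwa [show -Real.sin x - -x = -(Real.sin x - x) by ring, abs_neg] at this
  · rw [abs_of_nonneg hx, abs_of_nonpos (by linarith [Real.sin_le hx])]
    linarith [Real.sin_ge_sub_cube hx]

theorem summable_decay {t : ℝ} (ht : 0 < t) (θ : ℝ) :
    Summable fun p => weight t p * (1 - Real.cos (freq p * θ)) := by
  refine Summable.of_nonneg_of_le (fun p => ?_) (fun p => ?_) ((summable_weight_mul ht 0).mul_right 2)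
  · exact mul_nonneg (weight_pos t p).le (by linarith [Real.cos_le_one (freq p * θ)])
  · rw [pow_zero, mul_one]
    exact mul_le_mul_of_nonneg_left (by linarith [Real.neg_one_le_cos (freq p * θ)])
      (weight_pos t p).le

theorem abs_phase_term_le (t θ : ℝ) (p : ℕ × ℕ) :
    |weight t p * (Real.sin (freq p * θ) - freq p * θ)| ≤
      weight t p * freq p ^ 3 * (|θ| ^ 3 / 6) := by
  rw [abs_mul, abs_of_pos (weight_pos t p), mul_assoc]
  refine mul_le_mul_of_nonneg_left (sub_sin_le.trans_eq ?_) (weight_pos t p).le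
  rw [abs_mul, abs_of_pos (freq_pos p)]; ring

theorem summable_phase {t : ℝ} (ht : 0 < t) (θ : ℝ) :
    Summable fun p => weight t p * (Real.sin (freq p * θ) - freq p * θ) :=
  Summable.of_norm_bounded ((summable_weight_mul ht 3).mul_right _) (abs_phase_term_le t θ)

theorem decay_le {t : ℝ} (ht : 0 < t) (θ : ℝ) : decay t θ ≤ 1.645 / t ^ 3 * θ ^ 2 := by
  calc decay t θ ≤ ∑' p, weight t p * freq p ^ 2 * (θ ^ 2 / 2) := by
        refine (summable_decay ht θ).tsum_le_tsum (fun p => ?_) ((summable_weight_mul ht 2).mul_right _)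
        rw [mul_assoc]
        refine mul_le_mul_of_nonneg_left ?_ (weight_pos t p).le
        have := Real.one_sub_sq_div_two_le_cos (x := freq p * θ)
        nlinarith
    _ = (∑' p, weight t p * freq p ^ 2) * (θ ^ 2 / 2) := tsum_mul_right
    _ ≤ 1.645 * (2 / t ^ 3) * (θ ^ 2 / 2) := by
        have := cumulant_two_le ht
        have h2 := pi_sq_div_six_lt
        gcongr
        exact this.trans (by gcongr)
    _ = _ := by ring

theorem phase_sq_le {t : ℝ} (ht : 0 < t) (ht' : t ≤ 1 / 100) (θ : ℝ) :
    phase t θ ^ 2 ≤ 2.725 / t ^ 8 * θ ^ 6 := by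
  have h : |phase t θ| ≤ 1.6505 / t ^ 4 * |θ| ^ 3 := by
    calc |phase t θ| ≤ ∑' p, weight t p * freq p ^ 3 * (|θ| ^ 3 / 6) :=
          tsum_of_norm_bounded (E := ℝ) ((summable_weight_mul ht 3).mul_right _).hasSum
            (abs_phase_term_le t θ)
      _ = (∑' p, weight t p * freq p ^ 3) * (|θ| ^ 3 / 6) := tsum_mul_right
      _ ≤ (1.645 * (6 / t ^ 4) + 1.645 * (2 / t ^ 3)) * (|θ| ^ 3 / 6) := by
          have := cumulant_three_le ht
          have h2 := pi_sq_div_six_lt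
          gcongr
          exact this.trans (by gcongr)
      _ = 1.645 * (1 + t / 3) / t ^ 4 * |θ| ^ 3 := by field_simp; ring
      _ ≤ _ := by gcongr; linarith
  calc phase t θ ^ 2 = |phase t θ| ^ 2 := (sq_abs _).symm
    _ ≤ (1.6505 / t ^ 4 * |θ| ^ 3) ^ 2 := by gcongr
    _ = 1.6505 ^ 2 / t ^ 8 * (θ ^ 2) ^ 3 := by rw [← sq_abs θ]; field_simp
    _ ≤ _ := by
        rw [← pow_mul]
        have : (1.6505 : ℝ) ^ 2 ≤ 2.725 := by norm_num
        have : 0 ≤ θ ^ (2 * 3) := Even.pow_nonneg (by decide) θ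
        gcongr

theorem norm_charFn (t θ : ℝ) : ‖charFn t θ‖ = Real.exp (-decay t θ) := by
  rw [charFn, Complex.norm_exp]; simp

theorem ofReal_weight_mul_exp (t θ : ℝ) (p : ℕ × ℕ) :
    Complex.exp (-t + θ * Complex.I) ^ ((p.1 + 2) * (p.2 + 1)) / ((p.2 : ℂ) + 1) =
      weight t p * Complex.exp (freq p * θ * Complex.I) := by
  rw [← Complex.exp_nat_mul, weight]
  push_cast
  rw [div_mul_eq_mul_div, ← Complex.exp_add]
  congr 2
  unfold freq; push_cast; ring

theorem exp_tsum_eq_charFn {t : ℝ} (ht : 0 < t) {M : ℕ}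
    (hM : ∑' p, weight t p * freq p = M) (θ : ℝ) :
    Complex.exp (∑' p : ℕ × ℕ, Complex.exp (-t + θ * Complex.I) ^ ((p.1 + 2) * (p.2 + 1)) /
        ((p.2 : ℂ) + 1)) =
      Real.exp (∑' p, weight t p) * charFn t θ * Complex.exp (M * θ * Complex.I) := by
  have h0 := summable_weight_mul ht 0
  have h1 := summable_weight_mul ht 1
  simp only [pow_zero, mul_one] at h0
  simp only [pow_one] at h1
  have e0 := Complex.hasSum_ofReal.mpr h0.hasSum
  have e1 := Complex.hasSum_ofReal.mpr h1.hasSum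
  have e2 := Complex.hasSum_ofReal.mpr (summable_decay ht θ).hasSum
  have e3 := Complex.hasSum_ofReal.mpr (summable_phase ht θ).hasSum
  rw [hM] at e1
  have e := (((e0.sub e2).add (e3.mul_right Complex.I)).add (e1.mul_right (θ * Complex.I)))
  have e' : ∑' p : ℕ × ℕ, Complex.exp (-t + θ * Complex.I) ^ ((p.1 + 2) * (p.2 + 1)) /
        ((p.2 : ℂ) + 1) = _ := (tsum_congr fun p => by
    rw [ofReal_weight_mul_exp, Complex.exp_mul_I]
    push_cast; ring).trans e.tsum_eq
  rw [e', charFn, Complex.ofReal_exp, ← Complex.exp_add, ← Complex.exp_add]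
  congr 1
  unfold decay phase
  push_cast; ring

theorem hasSum_exp_mul_one_sub_cos {s : ℝ} (hs : 0 < s) (ϑ : ℝ) :
    HasSum (fun i : ℕ => Real.exp (-(((i : ℝ) + 1) * s)) * (1 - Real.cos (((i : ℝ) + 1) * ϑ)))
      ((1 + Real.exp (-s)) / (2 * (1 - Real.exp (-s))) * (2 * (1 - Real.cos ϑ) /
        (Real.exp s + Real.exp (-s) - 2 + 2 * (1 - Real.cos ϑ)))) := by
  set x := Real.exp (-s) with hx
  have hx0 : 0 < x := Real.exp_pos _
  have hx1 : x < 1 := exp_neg_lt_one hs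
  have hxi : Real.exp s = 1 / x := by rw [hx, Real.exp_neg]; simp
  have h1 := (hasSum_geometric_of_lt_one hx0.le hx1).mul_left x
  set z : ℂ := x * (Real.cos ϑ + Real.sin ϑ * Complex.I) with hz
  have hze : z = Complex.exp (-s + ϑ * Complex.I) := by
    rw [hz, Complex.exp_add, Complex.exp_mul_I, hx]; push_cast; rfl
  have hzn : ‖z‖ < 1 := by
    rw [hze, Complex.norm_exp]; simpa using hs
  have h2 := Complex.hasSum_re ((hasSum_geometric_of_norm_lt_one hzn).mul_left z)
  have hc := Real.cos_le_one ϑ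
  have hd : 0 < (1 - x) ^ 2 + 2 * x * (1 - Real.cos ϑ) :=
    add_pos_of_pos_of_nonneg (by have : 0 < 1 - x := by linarith
                                 positivity) (mul_nonneg (by positivity) (by linarith))
  have hsc := Real.sin_sq_add_cos_sq ϑ
  have hzr : z.re = x * Real.cos ϑ := by
    simp [hz, -Complex.ofReal_cos, -Complex.ofReal_sin]
  have hzi : z.im = x * Real.sin ϑ := by
    simp [hz, -Complex.ofReal_cos, -Complex.ofReal_sin]
  have hn : Complex.normSq (1 - z) = (1 - x) ^ 2 + 2 * x * (1 - Real.cos ϑ) := by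
    rw [Complex.normSq_apply]
    simp only [Complex.sub_re, Complex.sub_im, Complex.one_re, Complex.one_im, hzr, hzi]
    linear_combination x ^ 2 * hsc
  have hre : (z * (1 - z)⁻¹).re =
      (x * Real.cos ϑ - x ^ 2) / ((1 - x) ^ 2 + 2 * x * (1 - Real.cos ϑ)) := by
    rw [Complex.mul_re, Complex.inv_re, Complex.inv_im, hn]
    simp only [Complex.sub_re, Complex.sub_im, Complex.one_re, Complex.one_im, hzr, hzi]
    rw [← sub_eq_zero]
    generalize (1 - x) ^ 2 + 2 * x * (1 - Real.cos ϑ) = D at hd ⊢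
    have := hd.ne'
    field_simp
    linear_combination (-x ^ 2) * hsc
  refine hasSum_of_forall_eq (h1.sub h2) (fun i => ?_) ?_
  · have e1 : Real.exp (-(((i : ℝ) + 1) * s)) = x * x ^ i := by
      rw [← pow_succ', hx, ← Real.exp_nat_mul]; push_cast; congr 1; ring
    have e2 : z * z ^ i = ((x * x ^ i : ℝ) : ℂ) * Complex.exp ((((i + 1) * ϑ : ℝ) : ℂ) * Complex.I) := by
      rw [← e1, ← pow_succ', hze, ← Complex.exp_nat_mul, Complex.ofReal_exp, ← Complex.exp_add]
      push_cast; congr 1; ring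
    rw [e2, Complex.re_ofReal_mul, Complex.exp_ofReal_mul_I_re, e1]; ring
  · rw [hre, hxi]
    have h3 : (1 : ℝ) - x ≠ 0 := by linarith
    have h4 : 1 / x + x - 2 + 2 * (1 - Real.cos ϑ) =
        ((1 - x) ^ 2 + 2 * x * (1 - Real.cos ϑ)) / x := by field_simp; ring
    rw [h4]
    obtain ⟨D, hD⟩ : ∃ D, D = (1 - x) ^ 2 + 2 * x * (1 - Real.cos ϑ) := ⟨_, rfl⟩
    rw [← hD] at hd ⊢
    have := hd.ne'
    field_simp
    rw [hD]
    ring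

theorem inv_le_coth {s : ℝ} (hs : 0 < s) :
    1 / s ≤ (1 + Real.exp (-s)) / (2 * (1 - Real.exp (-s))) := by
  have h1 := exp_neg_lt_one hs
  rw [div_le_div_iff₀ hs (by linarith)]
  have hmono : MonotoneOn (fun y : ℝ => y * (1 + Real.exp (-y)) + 2 * Real.exp (-y))
      (Set.Ici 0) := by
    refine monotoneOn_of_deriv_nonneg (convex_Ici 0) (by fun_prop) (by fun_prop) fun y hy => ?_
    have hd : HasDerivAt (fun y : ℝ => y * (1 + Real.exp (-y)) + 2 * Real.exp (-y))
        (1 * (1 + Real.exp (-y)) + y * (Real.exp (-y) * -1) + 2 * (Real.exp (-y) * -1)) y := by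
      have he : HasDerivAt (fun y : ℝ => Real.exp (-y)) (Real.exp (-y) * -1) y :=
        (hasDerivAt_neg y).exp
      exact ((hasDerivAt_id y).mul (he.const_add 1)).add (he.const_mul 2)
    rw [hd.deriv]
    have : (y + 1) * Real.exp (-y) ≤ 1 := by
      rw [Real.exp_neg, ← div_eq_mul_inv, div_le_one (Real.exp_pos _)]
      exact Real.add_one_le_exp y
    linarith
  have := hmono Set.self_mem_Ici (Set.mem_Ici.mpr hs.le) hs.le
  simp at this
  linarith

theorem exp_add_exp_neg_le {s : ℝ} (hs : 0 ≤ s) (hs' : s ≤ 0.05) :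
    Real.exp s + Real.exp (-s) - 2 ≤ 1.0003 * s ^ 2 := by
  have h1 := abs_le.mp (Real.exp_bound (x := s) (by rw [abs_of_nonneg hs]; linarith)
    (n := 4) (by norm_num))
  have h2 := abs_le.mp (Real.exp_bound (x := -s) (by rw [abs_neg, abs_of_nonneg hs]; linarith)
    (n := 4) (by norm_num))
  rw [abs_neg, abs_of_nonneg hs] at h2
  rw [abs_of_nonneg hs] at h1
  norm_num [Finset.sum_range_succ, Nat.factorial] at h1 h2
  have h3 : s ^ 4 ≤ 0.0025 * s ^ 2 := by
    have : s ^ 2 ≤ 0.0025 := by nlinarith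
    nlinarith [sq_nonneg s]
  linarith [h1.2, h2.2]

theorem le_two_mul_one_sub_cos {ϑ : ℝ} (h : |ϑ| ≤ 0.15) :
    0.9976 * ϑ ^ 2 ≤ 2 * (1 - Real.cos ϑ) := by
  have h1 := (abs_le.mp (Real.cos_bound (x := ϑ) (by linarith))).2
  have h2 : |ϑ| ^ 4 ≤ 0.0225 * ϑ ^ 2 := by
    rw [← sq_abs ϑ]
    have : |ϑ| ^ 2 ≤ 0.0225 := by nlinarith [abs_nonneg ϑ]
    nlinarith [sq_nonneg |ϑ|]
  linarith [sq_nonneg ϑ]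

theorem div_add_le_div_add {a b c d : ℝ} (ha : 0 ≤ a) (hab : a ≤ b) (hc : 0 < c) (hcd : d ≤ c)
    (hd : 0 < d) : a / (c + a) ≤ b / (d + b) := by
  rw [div_le_div_iff₀ (by linarith) (by linarith)]
  nlinarith [mul_nonneg ha hd.le, mul_le_mul hab hcd hd.le (ha.trans hab)]

theorem le_tsum_exp_mul_one_sub_cos {s ϑ q : ℝ} (hs : 0 < s) (hs' : s ≤ 0.05) (hq : 0 ≤ q)
    (h : 0.9976 * q ≤ 2 * (1 - Real.cos ϑ)) :
    0.997 / s * (q / (s ^ 2 + q)) ≤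
      ∑' i : ℕ, Real.exp (-(((i : ℝ) + 1) * s)) * (1 - Real.cos (((i : ℝ) + 1) * ϑ)) := by
  rw [(hasSum_exp_mul_one_sub_cos hs ϑ).tsum_eq]
  have h1 := inv_le_coth hs
  have h2 := exp_add_exp_neg_le hs.le hs'
  have h3 : 0 < Real.exp s + Real.exp (-s) - 2 := by
    have : Real.exp s * Real.exp (-s) = 1 := by rw [← Real.exp_add]; simp
    nlinarith [sq_pos_of_pos (sub_pos.mpr (exp_neg_lt_one hs)), Real.exp_pos (-s),
      Real.exp_pos s, Real.add_one_lt_exp hs.ne', exp_neg_lt_one hs]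
  have h4 := div_add_le_div_add (mul_nonneg (by norm_num) hq) h (c := 1.0003 * s ^ 2)
    (by positivity) h2 h3
  have h5 : 0.997 * (q / (s ^ 2 + q)) ≤ 0.9976 * q / (1.0003 * s ^ 2 + 0.9976 * q) := by
    rw [← mul_div_assoc, div_le_div_iff₀ (by positivity) (by positivity)]
    nlinarith [mul_nonneg hq (sq_nonneg s), mul_nonneg hq hq]
  calc 0.997 / s * (q / (s ^ 2 + q)) = 1 / s * (0.997 * (q / (s ^ 2 + q))) := by ring
    _ ≤ _ := mul_le_mul h1 (h5.trans h4) (by positivity) (le_trans (by positivity) h1)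

theorem sum_tsum_le_tsum {h : ℕ × ℕ → ℝ} (hs : Summable h) (h0 : ∀ p, 0 ≤ h p) (N : ℕ) :
    ∑ j ∈ Finset.range N, ∑' i, h (i, j) ≤ ∑' p, h p := by
  have hs' : Summable fun p => h (Equiv.prodComm ℕ ℕ p) := (Equiv.prodComm ℕ ℕ).summable_iff.mpr hs
  rw [← (Equiv.prodComm ℕ ℕ).tsum_eq h, hs'.tsum_prod]
  exact hs'.prod.sum_le_tsum _ fun j _ => tsum_nonneg fun i => h0 _

/-- The contribution of the parts `i + 2` with multiplicity `j + 1` to the decay. -/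
theorem tsum_decay_fiber {t : ℝ} (ht : 0 < t) (θ : ℝ) (j : ℕ) :
    ∑' i : ℕ, weight t (i, j) * (1 - Real.cos (freq (i, j) * θ)) =
      ((∑' i : ℕ, Real.exp (-(((i : ℝ) + 1) * (((j : ℝ) + 1) * t))) *
        (1 - Real.cos (((i : ℝ) + 1) * (((j : ℝ) + 1) * θ)))) -
        Real.exp (-(((j : ℝ) + 1) * t)) * (1 - Real.cos (((j : ℝ) + 1) * θ))) / ((j : ℝ) + 1) := by
  have hs := (hasSum_exp_mul_one_sub_cos (s := ((j : ℝ) + 1) * t) (by positivity)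
    (((j : ℝ) + 1) * θ)).summable
  rw [hs.tsum_eq_zero_add]
  simp only [Nat.cast_zero, zero_add, one_mul, add_sub_cancel_left]
  rw [← tsum_div_const]
  refine tsum_congr fun i => ?_
  simp only [weight, freq]
  push_cast
  rw [div_mul_eq_mul_div]
  ring_nf

theorem le_decay_of_le {t θ : ℝ} (ht : 0 < t) (ht' : t ≤ 1 / 100) (hθ : |θ| ≤ 3 * t) :
    1.456 / t * (θ ^ 2 / (t ^ 2 + θ ^ 2)) ≤ decay t θ := by
  refine le_trans ?_ (sum_tsum_le_tsum (summable_decay ht θ) (fun p => mul_nonneg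
    (weight_pos t p).le (by linarith [Real.cos_le_one (freq p * θ)])) 5)
  have key : ∀ j ∈ Finset.range 5,
      (0.997 / t * (θ ^ 2 / (t ^ 2 + θ ^ 2))) / ((j : ℝ) + 1) ^ 2 - ((j : ℝ) + 1) * θ ^ 2 / 2 ≤
        ∑' i : ℕ, weight t (i, j) * (1 - Real.cos (freq (i, j) * θ)) := by
    intro j hj
    have hj' : (j : ℝ) + 1 ≤ 5 := by
      have := Finset.mem_range.mp hj
      exact_mod_cast (by omega : j + 1 ≤ 5)
    have hm : 0 < (j : ℝ) + 1 := by positivity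
    set m := (j : ℝ) + 1 with hmdef
    rw [tsum_decay_fiber ht]
    have h1 := le_tsum_exp_mul_one_sub_cos (s := m * t) (ϑ := m * θ) (q := (m * θ) ^ 2)
      (by positivity) (by nlinarith) (by positivity) (le_two_mul_one_sub_cos (by
        rw [abs_mul, abs_of_pos hm]; nlinarith [abs_nonneg θ]))
    have h2 : Real.exp (-(m * t)) * (1 - Real.cos (m * θ)) ≤ (m * θ) ^ 2 / 2 := by
      have h3 := exp_neg_lt_one (s := m * t) (by positivity)
      have h4 := Real.one_sub_sq_div_two_le_cos (x := m * θ)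
      nlinarith [Real.cos_le_one (m * θ)]
    rw [← hmdef, le_div_iff₀ hm]
    refine le_trans (le_of_eq ?_) (sub_le_sub h1 h2)
    have : 0 < t ^ 2 + θ ^ 2 := by positivity
    rw [mul_pow, mul_pow, ← mul_add, mul_div_mul_left _ _ (by positivity)]
    field_simp
  refine le_trans ?_ (Finset.sum_le_sum key)
  norm_num [Finset.sum_range_succ]
  have hθ2 : θ ^ 2 ≤ 9 * t ^ 2 := by
    rw [← sq_abs]; nlinarith [abs_nonneg θ]
  have hsmall : θ ^ 2 ≤ 0.0001 * (1 / t * (θ ^ 2 / (t ^ 2 + θ ^ 2))) := by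
    rcases eq_or_ne θ 0 with rfl | h0
    · simp
    · have : 0 < t ^ 2 + θ ^ 2 := by positivity
      rw [one_div_mul_eq_div, div_div, ← mul_div_assoc, le_div_iff₀ (by positivity)]
      have : (t ^ 2 + θ ^ 2) * t ≤ 0.0001 := by
        have : t ^ 2 ≤ 0.0001 := by nlinarith
        nlinarith
      nlinarith [sq_nonneg θ]
  have hK : 0 ≤ 1 / t * (θ ^ 2 / (t ^ 2 + θ ^ 2)) := by positivity
  set K := 1 / t * (θ ^ 2 / (t ^ 2 + θ ^ 2)) with hKdef
  have e1 : ∀ c : ℝ, c / t * (θ ^ 2 / (t ^ 2 + θ ^ 2)) = c * K := fun c => by rw [hKdef]; ring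
  simp only [e1]
  linarith

theorem le_decay_of_ge {t θ : ℝ} (ht : 0 < t) (ht' : t ≤ 1 / 100) (hθ : 3 * t ≤ |θ|)
    (hπ : |θ| ≤ Real.pi) : 0.89 / t - 2 ≤ decay t θ := by
  refine le_trans ?_ (sum_tsum_le_tsum (summable_decay ht θ) (fun p => mul_nonneg
    (weight_pos t p).le (by linarith [Real.cos_le_one (freq p * θ)])) 1)
  rw [Finset.sum_range_one, tsum_decay_fiber ht]
  simp only [Nat.cast_zero, zero_add, one_mul, div_one]
  have hc : Real.cos θ ≤ Real.cos (3 * t) := by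
    rw [← Real.cos_abs θ]
    exact Real.cos_le_cos_of_nonneg_of_le_pi (by positivity) hπ hθ
  have h0 := le_two_mul_one_sub_cos (ϑ := 3 * t) (by rw [abs_of_pos (by positivity)]; linarith)
  have h1 := le_tsum_exp_mul_one_sub_cos (s := t) (ϑ := θ) (q := (3 * t) ^ 2)
    ht (by linarith) (by positivity) (by linarith)
  have h2 : Real.exp (-t) * (1 - Real.cos θ) ≤ 2 := by
    nlinarith [exp_neg_lt_one ht, Real.neg_one_le_cos θ, Real.cos_le_one θ]
  refine sub_le_sub (le_trans ?_ h1) h2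
  have : (3 * t) ^ 2 / (t ^ 2 + (3 * t) ^ 2) = 9 / 10 := by field_simp; norm_num
  rw [this, div_mul_eq_mul_div]
  gcongr; norm_num

theorem norm_charFn_le_of_near {t θ : ℝ} (ht : 0 < t) (ht' : t ≤ 1 / 100) (hθ : |θ| ≤ 0.3 * t) :
    ‖charFn t θ‖ ≤ Real.exp (-(1.33 / t ^ 3) * θ ^ 2) := by
  rw [norm_charFn, Real.exp_le_exp, neg_mul, neg_le_neg_iff]
  refine le_trans ?_ (le_decay_of_le ht ht' (hθ.trans (by linarith)))
  have h : θ ^ 2 ≤ 0.09 * t ^ 2 := by rw [← sq_abs]; nlinarith [abs_nonneg θ]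
  rw [div_mul_div_comm, div_mul_eq_mul_div, div_le_div_iff₀ (by positivity) (by positivity)]
  have : 0 ≤ θ ^ 2 * t := by positivity
  nlinarith [mul_le_mul_of_nonneg_left h this]

theorem norm_charFn_le_of_mid {t θ : ℝ} (ht : 0 < t) (ht' : t ≤ 1 / 100) (h1 : 0.3 * t ≤ |θ|)
    (h2 : |θ| ≤ 3 * t) :
    ‖charFn t θ‖ ≤ Real.exp (-0.108 / t) * Real.exp (-(0.13 / t ^ 3) * θ ^ 2) := by
  rw [norm_charFn, ← Real.exp_add, Real.exp_le_exp, neg_div, neg_mul, ← neg_add, neg_le_neg_iff]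
  refine le_trans ?_ (le_decay_of_le ht ht' h2)
  have h : 0.09 * t ^ 2 ≤ θ ^ 2 := by rw [← sq_abs θ]; nlinarith [abs_nonneg θ]
  have h' : θ ^ 2 ≤ 9 * t ^ 2 := by rw [← sq_abs]; nlinarith [abs_nonneg θ]
  have e : 0.108 / t + 0.13 / t ^ 3 * θ ^ 2 = (0.108 * t ^ 2 + 0.13 * θ ^ 2) / t ^ 3 := by
    field_simp
  rw [e, div_mul_div_comm, div_le_div_iff₀ (by positivity) (by positivity)]
  have : 0 ≤ t * ((θ ^ 2 - 0.09 * t ^ 2) * (9 * t ^ 2 - θ ^ 2)) :=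
    mul_nonneg ht.le (mul_nonneg (by linarith) (by linarith))
  have h3 : 0 ≤ t ^ 3 * (θ ^ 2 - 0.09 * t ^ 2) := mul_nonneg (by positivity) (by linarith)
  have h4 : 0 ≤ t ^ 3 * θ ^ 2 := by positivity
  nlinarith

theorem norm_charFn_le_of_far {t θ : ℝ} (ht : 0 < t) (ht' : t ≤ 1 / 100) (h1 : 3 * t ≤ |θ|)
    (h2 : |θ| ≤ Real.pi) :
    ‖charFn t θ‖ ≤ Real.exp (2 - 0.8 / t) * Real.exp (-(0.009 / t) * θ ^ 2) := by
  rw [norm_charFn, ← Real.exp_add, Real.exp_le_exp]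
  have h := le_decay_of_ge ht ht' h1 h2
  have h3 : θ ^ 2 ≤ 9.87 := by
    rw [← sq_abs]; nlinarith [abs_nonneg θ, Real.pi_lt_d6, Real.pi_pos]
  have h4 : 0.009 / t * θ ^ 2 ≤ 0.09 / t := by
    rw [div_mul_eq_mul_div]; gcongr; linarith
  have e : 0.89 / t = 0.8 / t + 0.09 / t := by ring
  linarith

theorem le_norm_charFn {t : ℝ} (ht : 0 < t) (θ : ℝ) :
    Real.exp (-(1.645 / t ^ 3) * θ ^ 2) ≤ ‖charFn t θ‖ := by
  rw [norm_charFn, Real.exp_le_exp, neg_mul, neg_le_neg_iff]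
  exact decay_le ht θ

theorem le_re_charFn_mul {t : ℝ} (x y : ℝ) :
    ‖charFn t x‖ * ‖charFn t y‖ * (1 - phase t x ^ 2 - phase t y ^ 2) ≤
      (charFn t x * charFn t y).re := by
  have h : (charFn t x * charFn t y).re =
      ‖charFn t x‖ * ‖charFn t y‖ * Real.cos (phase t x + phase t y) := by
    rw [norm_charFn, norm_charFn, charFn, charFn, ← Complex.exp_add, Complex.exp_re, ← Real.exp_add]
    simp
  rw [h]
  refine mul_le_mul_of_nonneg_left ?_ (by positivity)
  have := Real.one_sub_sq_div_two_le_cos (x := phase t x + phase t y)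
  nlinarith [sq_nonneg (phase t x - phase t y)]

theorem hasSum_charFn {t : ℝ} (ht : 0 < t) {M : ℕ} (hM : ∑' p, weight t p * freq p = M) (θ : ℝ) :
    HasSum (fun n => ((noOnes n * Real.exp (-(n * t)) / Real.exp (∑' p, weight t p) : ℝ) : ℂ) *
      Complex.exp (((n : ℂ) - M) * θ * Complex.I)) (charFn t θ) := by
  have hq : ‖Complex.exp (-t + θ * Complex.I)‖ < 1 := by
    rw [Complex.norm_exp]; simpa using ht
  have h := hasSum_noOnes hq
  rw [exp_tsum_eq_charFn ht hM] at h
  have h2 := h.mul_right (Complex.exp (-(M * θ * Complex.I)) / Real.exp (∑' p, weight t p))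
  have e0 : ((Real.exp (∑' p, weight t p) : ℝ) : ℂ) ≠ 0 := by
    exact_mod_cast (Real.exp_pos _).ne'
  convert! h2 using 1
  · ext n
    have e1 : Complex.exp (-t + θ * Complex.I) ^ n =
        Real.exp (-(n * t)) * Complex.exp (n * θ * Complex.I) := by
      rw [← Complex.exp_nat_mul, Complex.ofReal_exp, ← Complex.exp_add]; push_cast; ring_nf
    have e2 : Complex.exp (((n : ℂ) - M) * θ * Complex.I) =
        Complex.exp (n * θ * Complex.I) * Complex.exp (-(M * θ * Complex.I)) := by
      rw [← Complex.exp_add]; ring_nf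
    rw [e1, e2]
    push_cast
    ring
  · rw [mul_div_assoc', mul_assoc _ (Complex.exp _) (Complex.exp _), ← Complex.exp_add]
    simp only [add_neg_cancel, Complex.exp_zero, mul_one]
    rw [mul_div_cancel_left₀ _ e0]

theorem integral_exp_int_mul (k : ℤ) :
    ∫ θ in (-Real.pi)..Real.pi, Complex.exp (k * θ * Complex.I) =
      if k = 0 then 2 * (Real.pi : ℂ) else 0 := by
  split_ifs with h
  · subst h; simp; ring
  · have hk : (k : ℂ) * Complex.I ≠ 0 := mul_ne_zero (by exact_mod_cast h) Complex.I_ne_zero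
    have := integral_exp_mul_complex (a := -Real.pi) (b := Real.pi) hk
    simp only [mul_right_comm _ Complex.I] at this
    rw [this, div_eq_zero_iff]
    left
    have e : (k : ℂ) * (Real.pi : ℝ) * Complex.I =
        k * ((-Real.pi : ℝ) : ℂ) * Complex.I + k * (2 * Real.pi * Complex.I) := by
      push_cast; ring
    rw [e, Complex.exp_add, Complex.exp_int_mul_two_pi_mul_I, mul_one, sub_self]

theorem norm_mul_exp_mul_I (b x : ℝ) : ‖(b : ℂ) * Complex.exp (x * Complex.I)‖ = |b| := by
  rw [norm_mul, Complex.norm_exp_ofReal_mul_I, mul_one, Complex.norm_real, Real.norm_eq_abs]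

theorem summable_abs_of_hasSum {b : ℕ → ℝ} {M : ℕ} {f : ℝ → ℂ}
    (hf : ∀ θ : ℝ, HasSum
        (fun n => (b n : ℂ) * Complex.exp (((n : ℂ) - M) * θ * Complex.I)) (f θ)) :
    Summable fun n => |b n| := by
  have := (hf 0).summable
  simp only [Complex.ofReal_zero, mul_zero, zero_mul, Complex.exp_zero, mul_one] at this
  exact (Complex.summable_ofReal.mp this).abs

theorem norm_term (b : ℝ) (n M : ℕ) (θ : ℝ) :
    ‖(b : ℂ) * Complex.exp (((n : ℂ) - M) * θ * Complex.I)‖ = |b| := by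
  rw [← norm_mul_exp_mul_I b (((n : ℝ) - M) * θ)]
  push_cast; rfl

theorem continuous_of_hasSum {b : ℕ → ℝ} {M : ℕ} {f : ℝ → ℂ}
    (hf : ∀ θ : ℝ, HasSum
        (fun n => (b n : ℂ) * Complex.exp (((n : ℂ) - M) * θ * Complex.I)) (f θ)) :
    Continuous f := by
  rw [show f = fun θ => ∑' n, _ from funext fun θ => (hf θ).tsum_eq.symm]
  exact continuous_tsum (fun n => by fun_prop) (summable_abs_of_hasSum hf)
    fun n θ => (norm_term _ _ _ _).le

theorem integral_mul_exp_eq {b : ℕ → ℝ} {M : ℕ} {f : ℝ → ℂ}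
    (hf : ∀ θ : ℝ, HasSum (fun n => (b n : ℂ) * Complex.exp (((n : ℂ) - M) * θ * Complex.I)) (f θ))
    (k : ℕ) :
    ∫ θ in (-Real.pi)..Real.pi, f θ * Complex.exp (((M : ℂ) - k) * θ * Complex.I) =
      2 * Real.pi * b k := by
  have h := intervalIntegral.hasSum_integral_of_dominated_convergence (μ := MeasureTheory.volume)
    (a := -Real.pi) (b := Real.pi)
    (F := fun n θ => (b n : ℂ) * Complex.exp (((n : ℂ) - M) * θ * Complex.I) *
      Complex.exp (((M : ℂ) - k) * θ * Complex.I))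
    (f := fun θ => f θ * Complex.exp (((M : ℂ) - k) * θ * Complex.I))
    (fun n _ => |b n|) (fun n => by
      apply Continuous.aestronglyMeasurable; fun_prop)
    (fun n => Filter.Eventually.of_forall fun θ _ => by
      have := norm_mul_exp_mul_I 1 (((M : ℝ) - k) * θ)
      rw [abs_one] at this
      push_cast at this
      rw [norm_mul, norm_term, ← one_mul (Complex.exp _), this, mul_one])
    (Filter.Eventually.of_forall fun θ _ => summable_abs_of_hasSum hf) (by simp)
    (Filter.Eventually.of_forall fun θ _ => (hf θ).mul_right _)
  have e : ∀ n, ∫ θ in (-Real.pi)..Real.pi, (b n : ℂ) * Complex.exp (((n : ℂ) - M) * θ * Complex.I) *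
      Complex.exp (((M : ℂ) - k) * θ * Complex.I) = if n = k then 2 * Real.pi * (b k : ℂ) else 0 := by
    intro n
    have e1 : ∀ θ : ℝ, (b n : ℂ) * Complex.exp (((n : ℂ) - M) * θ * Complex.I) *
        Complex.exp (((M : ℂ) - k) * θ * Complex.I) =
        b n * Complex.exp (((n - k : ℤ) : ℂ) * θ * Complex.I) := fun θ => by
      rw [mul_assoc, ← Complex.exp_add]; push_cast; ring_nf
    simp only [e1]
    rw [intervalIntegral.integral_const_mul, integral_exp_int_mul]
    simp only [sub_eq_zero, Nat.cast_inj]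
    split_ifs with hnk
    · rw [hnk]; ring
    · ring
  simp only [e] at h
  exact h.unique (hasSum_ite_eq k _)

/-! ### Gaussian double integrals -/

/-- The function `f` is integrable on the plane, with integral `a`. -/
def HasPlaneIntegral (f : ℝ × ℝ → ℝ) (a : ℝ) : Prop :=
  MeasureTheory.Integrable f ∧ ∫ z, f z = a

theorem HasPlaneIntegral.add {f g : ℝ × ℝ → ℝ} {a b : ℝ} (hf : HasPlaneIntegral f a)
    (hg : HasPlaneIntegral g b) : HasPlaneIntegral (fun z => f z + g z) (a + b) :=
  ⟨hf.1.add hg.1, by rw [MeasureTheory.integral_add hf.1 hg.1, hf.2, hg.2]⟩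

theorem HasPlaneIntegral.const_mul {f : ℝ × ℝ → ℝ} {a : ℝ} (hf : HasPlaneIntegral f a) (c : ℝ) :
    HasPlaneIntegral (fun z => c * f z) (c * a) :=
  ⟨hf.1.const_mul c, by rw [MeasureTheory.integral_const_mul, hf.2]⟩

theorem HasPlaneIntegral.of_eq {f g : ℝ × ℝ → ℝ} {a b : ℝ} (hf : HasPlaneIntegral f a)
    (hfg : ∀ z, g z = f z) (hab : b = a) : HasPlaneIntegral g b := by
  rw [hab, funext hfg]; exact hf

theorem integrable_pow_mul_gaussian {b : ℝ} (hb : 0 < b) (n : ℕ) :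
    MeasureTheory.Integrable fun x : ℝ => x ^ n * Real.exp (-b * x ^ 2) := by
  have := integrable_rpow_mul_exp_neg_mul_sq hb (s := n) (by linarith [n.cast_nonneg (α := ℝ)])
  simpa only [Real.rpow_natCast] using this

theorem integral_pow_mul_gaussian_add_two {b : ℝ} (hb : 0 < b) (n : ℕ) :
    ∫ x : ℝ, x ^ (n + 2) * Real.exp (-b * x ^ 2) =
      (n + 1) / (2 * b) * ∫ x : ℝ, x ^ n * Real.exp (-b * x ^ 2) := by
  have hd : ∀ x : ℝ, HasDerivAt (fun x : ℝ => x ^ (n + 1) * Real.exp (-b * x ^ 2))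
      ((n + 1) * (x ^ n * Real.exp (-b * x ^ 2)) -
        2 * b * (x ^ (n + 2) * Real.exp (-b * x ^ 2))) x := fun x => by
    have h1 : HasDerivAt (fun x : ℝ => Real.exp (-b * x ^ 2))
        (Real.exp (-b * x ^ 2) * (-b * (2 * x))) x := by
      simpa using ((hasDerivAt_pow 2 x).const_mul (-b)).exp
    have := (hasDerivAt_pow (n + 1) x).mul h1
    convert! this using 1
    simp only [Nat.add_sub_cancel]
    push_cast
    ring
  have hi := (integrable_pow_mul_gaussian hb n).const_mul ((n : ℝ) + 1)
  have hi2 := (integrable_pow_mul_gaussian hb (n + 2)).const_mul (2 * b)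
  have h := MeasureTheory.integral_eq_zero_of_hasDerivAt_of_integrable hd (hi.sub hi2)
    (integrable_pow_mul_gaussian hb (n + 1))
  rw [MeasureTheory.integral_sub hi hi2, MeasureTheory.integral_const_mul,
    MeasureTheory.integral_const_mul] at h
  rw [div_mul_eq_mul_div, eq_div_iff (by positivity)]
  linarith

theorem integral_pow_mul_gaussian_one {b : ℝ} (hb : 0 < b) :
    ∫ x : ℝ, x ^ 1 * Real.exp (-b * x ^ 2) = 0 := by
  have hd : ∀ x : ℝ, HasDerivAt (fun x : ℝ => Real.exp (-b * x ^ 2))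
      (-(2 * b) * (x ^ 1 * Real.exp (-b * x ^ 2))) x := fun x => by
    have := ((hasDerivAt_pow 2 x).const_mul (-b)).exp
    convert! this using 1
    push_cast
    ring
  have hi := (integrable_pow_mul_gaussian hb 1).const_mul (-(2 * b))
  have h := MeasureTheory.integral_eq_zero_of_hasDerivAt_of_integrable hd hi
    (integrable_exp_neg_mul_sq hb)
  rw [MeasureTheory.integral_const_mul] at h
  have : -(2 * b) ≠ 0 := by linarith
  exact (mul_eq_zero.mp h).resolve_left this

theorem hasPlaneIntegral_pow_mul_pow {p q : ℝ} (hp : 0 < p) (hq : 0 < q) (m n : ℕ) :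
    HasPlaneIntegral
      (fun z => (z.1 ^ m * Real.exp (-p * z.1 ^ 2)) * (z.2 ^ n * Real.exp (-q * z.2 ^ 2)))
      ((∫ x : ℝ, x ^ m * Real.exp (-p * x ^ 2)) * ∫ x : ℝ, x ^ n * Real.exp (-q * x ^ 2)) :=
  ⟨(integrable_pow_mul_gaussian hp m).mul_prod (integrable_pow_mul_gaussian hq n),
    MeasureTheory.integral_prod_mul (μ := MeasureTheory.volume) (ν := MeasureTheory.volume)
      (fun x : ℝ => x ^ m * Real.exp (-p * x ^ 2)) (fun x : ℝ => x ^ n * Real.exp (-q * x ^ 2))⟩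

theorem hasPlaneIntegral_sub_pow_four {p q : ℝ} (hp : 0 < p) (hq : 0 < q) :
    HasPlaneIntegral (fun z => (z.1 - z.2) ^ 4 *
        (Real.exp (-p * z.1 ^ 2) * Real.exp (-q * z.2 ^ 2)))
      (√(Real.pi / p) * √(Real.pi / q) * (3 / 4 * (1 / p + 1 / q) ^ 2)) := by
  have h := fun m n => hasPlaneIntegral_pow_mul_pow hp hq m n
  refine ((((h 4 0).add ((h 3 1).const_mul (-4))).add ((h 2 2).const_mul 6)).add
    (((h 1 3).const_mul (-4)).add (h 0 4))).of_eq (fun z => by ring) ?_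
  have e0 : ∀ {b : ℝ}, ∫ x : ℝ, x ^ 0 * Real.exp (-b * x ^ 2) = √(Real.pi / b) := fun {b} => by
    simpa using integral_gaussian b
  have r := fun n => integral_pow_mul_gaussian_add_two hp n
  have r' := fun n => integral_pow_mul_gaussian_add_two hq n
  rw [r 2, r 1, r 0, r' 2, r' 1, r' 0, integral_pow_mul_gaussian_one hp, e0, e0]
  push_cast
  field_simp
  ring

theorem hasPlaneIntegral_add_pow_six {p : ℝ} (hp : 0 < p) :
    HasPlaneIntegral (fun z => (z.1 - z.2) ^ 4 * ((z.1 ^ 6 + z.2 ^ 6) *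
        (Real.exp (-p * z.1 ^ 2) * Real.exp (-p * z.2 ^ 2)))) (101.25 * Real.pi / p ^ 6) := by
  have h := fun m n => hasPlaneIntegral_pow_mul_pow hp hp m n
  refine (((((h 10 0).add ((h 9 1).const_mul (-4))).add ((h 8 2).const_mul 6)).add
    (((h 7 3).const_mul (-4)).add (h 6 4))).add ((((h 4 6).add ((h 3 7).const_mul (-4))).add
    ((h 2 8).const_mul 6)).add (((h 1 9).const_mul (-4)).add (h 0 10)))).of_eq
    (fun z => by ring) ?_
  have e0 : ∀ {b : ℝ}, ∫ x : ℝ, x ^ 0 * Real.exp (-b * x ^ 2) = √(Real.pi / b) := fun {b} => by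
    simpa using integral_gaussian b
  have r := fun n => integral_pow_mul_gaussian_add_two hp n
  have hs : √(Real.pi / p) ^ 2 = Real.pi / p := Real.sq_sqrt (by positivity)
  rw [r 8, r 7, r 6, r 5, r 4, r 3, r 2, r 1, r 0, integral_pow_mul_gaussian_one hp, e0]
  push_cast
  generalize √(Real.pi / p) = s at hs
  rw [eq_div_iff hp.ne'] at hs
  rw [← hs]
  field_simp
  ring

theorem two_mul_one_sub_cos_sq_le (x : ℝ) : 2 * (1 - Real.cos x) ^ 2 ≤ 1 / 2 * x ^ 4 := by
  have h1 := Real.one_sub_sq_div_two_le_cos (x := x)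
  have h2 := Real.cos_le_one x
  have : (1 - Real.cos x) ^ 2 ≤ (x ^ 2 / 2) ^ 2 := by gcongr; linarith
  nlinarith

theorem le_two_mul_one_sub_cos_sq {x : ℝ} (hx : |x| ≤ 0.006) :
    0.999 * (1 / 2 * x ^ 4) ≤ 2 * (1 - Real.cos x) ^ 2 := by
  have h1 := (abs_le.mp (Real.cos_bound (x := x) (by linarith))).2
  have h2 : |x| ^ 4 ≤ 0.000036 * x ^ 2 := by
    rw [← sq_abs x]
    have : |x| ^ 2 ≤ 0.000036 := by nlinarith [abs_nonneg x]
    nlinarith [sq_nonneg |x|]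
  have h3 : 0.9996 * (x ^ 2 / 2) ≤ 1 - Real.cos x := by linarith [sq_nonneg x]
  have : (0.9996 * (x ^ 2 / 2)) ^ 2 ≤ (1 - Real.cos x) ^ 2 := by gcongr
  have h4 : 0 ≤ x ^ 4 := by positivity
  nlinarith

/-- A bound for the characteristic function away from the saddle point. -/
noncomputable def tailBound (t θ : ℝ) : ℝ :=
  Real.exp (-0.108 / t) * Real.exp (-(0.13 / t ^ 3) * θ ^ 2) +
    Real.exp (2 - 0.8 / t) * Real.exp (-(0.009 / t) * θ ^ 2)

theorem tailBound_nonneg (t θ : ℝ) : 0 ≤ tailBound t θ := by unfold tailBound; positivity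

theorem norm_charFn_le_tailBound {t θ : ℝ} (ht : 0 < t) (ht' : t ≤ 1 / 100)
    (h1 : 0.3 * t < |θ|) (h2 : |θ| ≤ Real.pi) : ‖charFn t θ‖ ≤ tailBound t θ := by
  unfold tailBound
  rcases le_total |θ| (3 * t) with h | h
  · exact (norm_charFn_le_of_mid ht ht' h1.le h).trans (le_add_of_nonneg_right (by positivity))
  · exact (norm_charFn_le_of_far ht ht' h h2).trans (le_add_of_nonneg_left (by positivity))

theorem norm_charFn_le_add {t θ : ℝ} (ht : 0 < t) (ht' : t ≤ 1 / 100) (h2 : |θ| ≤ Real.pi) :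
    ‖charFn t θ‖ ≤ Real.exp (-(1.33 / t ^ 3) * θ ^ 2) + tailBound t θ := by
  rcases le_or_gt |θ| (0.3 * t) with h | h
  · exact (norm_charFn_le_of_near ht ht' h).trans (le_add_of_nonneg_right (tailBound_nonneg t θ))
  · exact (norm_charFn_le_tailBound ht ht' h h2).trans (le_add_of_nonneg_left (by positivity))

theorem gaussian_le_tailBound {t θ : ℝ} (ht : 0 < t) (h1 : 0.3 * t < |θ|) :
    Real.exp (-(1.645 / t ^ 3) * θ ^ 2) ≤ tailBound t θ := by
  refine le_trans ?_ (le_add_of_nonneg_right (by positivity))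
  rw [← Real.exp_add, Real.exp_le_exp]
  have h : 0.09 * t ^ 2 ≤ θ ^ 2 := by rw [← sq_abs θ]; nlinarith [abs_nonneg θ]
  have e : -0.108 / t + -(0.13 / t ^ 3) * θ ^ 2 =
      -((0.108 * t ^ 2 + 0.13 * θ ^ 2) / t ^ 3) := by field_simp; ring
  rw [e, neg_mul, neg_le_neg_iff, div_mul_eq_mul_div]
  gcongr
  nlinarith

/-- The lower bound for the integrand of the Laguerre double integral, with the factor
`(x - y) ^ 4 / 2` removed. -/
noncomputable def lowerBound (t x y : ℝ) : ℝ :=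
  0.999 * (Real.exp (-(1.645 / t ^ 3) * x ^ 2) * Real.exp (-(1.645 / t ^ 3) * y ^ 2)) -
    2.725 / t ^ 8 * ((x ^ 6 + y ^ 6) *
      (Real.exp (-(1.33 / t ^ 3) * x ^ 2) * Real.exp (-(1.33 / t ^ 3) * y ^ 2))) -
    2 * (tailBound t x * (Real.exp (-(1.33 / t ^ 3) * y ^ 2) + tailBound t y) +
      (Real.exp (-(1.33 / t ^ 3) * x ^ 2) + tailBound t x) * tailBound t y)

theorem gaussian_mono {t θ : ℝ} (ht : 0 < t) {a b : ℝ} (hab : a ≤ b) :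
    Real.exp (-(b / t ^ 3) * θ ^ 2) ≤ Real.exp (-(a / t ^ 3) * θ ^ 2) := by
  gcongr

theorem le_tail_mul {t x y : ℝ} {f g : ℝ} (hy : 0 ≤ g)
    (h : (f ≤ tailBound t x ∧ g ≤ Real.exp (-(1.33 / t ^ 3) * y ^ 2) + tailBound t y) ∨
      (f ≤ Real.exp (-(1.33 / t ^ 3) * x ^ 2) + tailBound t x ∧ g ≤ tailBound t y)) :
    f * g ≤ tailBound t x * (Real.exp (-(1.33 / t ^ 3) * y ^ 2) + tailBound t y) +
      (Real.exp (-(1.33 / t ^ 3) * x ^ 2) + tailBound t x) * tailBound t y := by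
  have h1 := tailBound_nonneg t x
  have h2 := tailBound_nonneg t y
  rcases h with h | h
  · exact (mul_le_mul h.1 h.2 hy h1).trans (le_add_of_nonneg_right (by positivity))
  · exact (mul_le_mul h.1 h.2 hy (by positivity)).trans (le_add_of_nonneg_left (by positivity))

theorem gaussian_mul_le_of_far {t x y : ℝ} (ht : 0 < t)
    (h : 0.3 * t < |x| ∨ 0.3 * t < |y|) :
    Real.exp (-(1.645 / t ^ 3) * x ^ 2) * Real.exp (-(1.645 / t ^ 3) * y ^ 2) ≤
      tailBound t x * (Real.exp (-(1.33 / t ^ 3) * y ^ 2) + tailBound t y) +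
      (Real.exp (-(1.33 / t ^ 3) * x ^ 2) + tailBound t x) * tailBound t y := by
  have hg : ∀ θ, Real.exp (-(1.645 / t ^ 3) * θ ^ 2) ≤
      Real.exp (-(1.33 / t ^ 3) * θ ^ 2) + tailBound t θ := fun θ =>
    (gaussian_mono ht (by norm_num)).trans (le_add_of_nonneg_right (tailBound_nonneg t θ))
  refine le_tail_mul (by positivity) ?_
  rcases h with h | h
  · exact Or.inl ⟨gaussian_le_tailBound ht h, hg y⟩
  · exact Or.inr ⟨hg x, gaussian_le_tailBound ht h⟩

theorem lowerBound_nonpos_of_far {t x y : ℝ} (ht : 0 < t)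
    (h : 0.3 * t < |x| ∨ 0.3 * t < |y|) : lowerBound t x y ≤ 0 := by
  have h1 := gaussian_mul_le_of_far ht h
  have h2 : 0 ≤ 2.725 / t ^ 8 * ((x ^ 6 + y ^ 6) *
      (Real.exp (-(1.33 / t ^ 3) * x ^ 2) * Real.exp (-(1.33 / t ^ 3) * y ^ 2))) := by positivity
  have h3 : 0 ≤ Real.exp (-(1.645 / t ^ 3) * x ^ 2) * Real.exp (-(1.645 / t ^ 3) * y ^ 2) := by
    positivity
  unfold lowerBound
  linarith

theorem lowerBound_mul_le {t x y : ℝ} (ht : 0 < t) (ht' : t ≤ 1 / 100) (hx : |x| ≤ Real.pi)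
    (hy : |y| ≤ Real.pi) :
    1 / 2 * ((x - y) ^ 4 * lowerBound t x y) ≤
      (charFn t x * charFn t y).re * (2 * (1 - Real.cos (x - y)) ^ 2) := by
  set W := 2 * (1 - Real.cos (x - y)) ^ 2 with hW
  have hW0 : 0 ≤ W := by positivity
  have hWle : W ≤ 1 / 2 * (x - y) ^ 4 := two_mul_one_sub_cos_sq_le (x - y)
  have hw0 : 0 ≤ 1 / 2 * (x - y) ^ 4 := by positivity
  by_cases h : 0.3 * t < |x| ∨ 0.3 * t < |y|
  · set Z := tailBound t x * (Real.exp (-(1.33 / t ^ 3) * y ^ 2) + tailBound t y) +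
      (Real.exp (-(1.33 / t ^ 3) * x ^ 2) + tailBound t x) * tailBound t y with hZ
    have h1 : lowerBound t x y ≤ -Z := by
      have h1 := gaussian_mul_le_of_far ht h
      have h2 : 0 ≤ 2.725 / t ^ 8 * ((x ^ 6 + y ^ 6) *
        (Real.exp (-(1.33 / t ^ 3) * x ^ 2) * Real.exp (-(1.33 / t ^ 3) * y ^ 2))) := by positivity
      have h3 : 0 ≤ Real.exp (-(1.645 / t ^ 3) * x ^ 2) * Real.exp (-(1.645 / t ^ 3) * y ^ 2) := by
        positivity
      unfold lowerBound
      linarith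
    have h2 : ‖charFn t x‖ * ‖charFn t y‖ ≤ Z := by
      refine le_tail_mul (norm_nonneg _) ?_
      rcases h with h | h
      · exact Or.inl ⟨norm_charFn_le_tailBound ht ht' h hx, norm_charFn_le_add ht ht' hy⟩
      · exact Or.inr ⟨norm_charFn_le_add ht ht' hx, norm_charFn_le_tailBound ht ht' h hy⟩
    have h3 : -(‖charFn t x‖ * ‖charFn t y‖) ≤ (charFn t x * charFn t y).re := by
      rw [← norm_mul]
      exact (abs_le.mp (Complex.abs_re_le_norm _)).1
    have hZ0 : 0 ≤ Z := le_trans (by positivity) h2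
    calc 1 / 2 * ((x - y) ^ 4 * lowerBound t x y) = 1 / 2 * (x - y) ^ 4 * lowerBound t x y := by ring
      _ ≤ 1 / 2 * (x - y) ^ 4 * -Z := mul_le_mul_of_nonneg_left h1 hw0
      _ ≤ -Z * W := by nlinarith
      _ ≤ _ := mul_le_mul_of_nonneg_right (by linarith) hW0
  · push Not at h
    have hWge : 0.999 * (1 / 2 * (x - y) ^ 4) ≤ W := le_two_mul_one_sub_cos_sq (by
      have := abs_sub x y
      linarith [h.1, h.2])
    set G := Real.exp (-(1.645 / t ^ 3) * x ^ 2) * Real.exp (-(1.645 / t ^ 3) * y ^ 2) with hG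
    set E := Real.exp (-(1.33 / t ^ 3) * x ^ 2) * Real.exp (-(1.33 / t ^ 3) * y ^ 2) with hE
    have hGn : G ≤ ‖charFn t x‖ * ‖charFn t y‖ :=
      mul_le_mul (le_norm_charFn ht x) (le_norm_charFn ht y) (by positivity) (norm_nonneg _)
    have hnE : ‖charFn t x‖ * ‖charFn t y‖ ≤ E :=
      mul_le_mul (norm_charFn_le_of_near ht ht' h.1) (norm_charFn_le_of_near ht ht' h.2)
        (by positivity) (by positivity)
    have hG0 : 0 ≤ G := by positivity
    set P := 2.725 / t ^ 8 * (x ^ 6 + y ^ 6) with hP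
    have hP0 : 0 ≤ P := by positivity
    have hph : phase t x ^ 2 + phase t y ^ 2 ≤ P := by
      rw [hP, mul_add]
      exact add_le_add (phase_sq_le ht ht' x) (phase_sq_le ht ht' y)
    have hre := le_re_charFn_mul (t := t) x y
    have h1 := tailBound_nonneg t x
    have h2 := tailBound_nonneg t y
    have hL : lowerBound t x y ≤ 0.999 * G - P * E := by
      have : 0 ≤ tailBound t x * (Real.exp (-(1.33 / t ^ 3) * y ^ 2) + tailBound t y) +
        (Real.exp (-(1.33 / t ^ 3) * x ^ 2) + tailBound t x) * tailBound t y := by positivity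
      unfold lowerBound
      rw [hP, hG, hE]
      linarith
    have hN : G - P * E ≤ (charFn t x * charFn t y).re := by
      refine le_trans ?_ hre
      have : (‖charFn t x‖ * ‖charFn t y‖) * (phase t x ^ 2 + phase t y ^ 2) ≤ E * P :=
        mul_le_mul hnE hph (by positivity) (by positivity)
      linarith
    have hPE : 0 ≤ P * E := by positivity
    calc 1 / 2 * ((x - y) ^ 4 * lowerBound t x y) = 1 / 2 * (x - y) ^ 4 * lowerBound t x y := by ring
      _ ≤ 1 / 2 * (x - y) ^ 4 * (0.999 * G - P * E) := mul_le_mul_of_nonneg_left hL hw0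
      _ ≤ (G - P * E) * W := by nlinarith
      _ ≤ _ := mul_le_mul_of_nonneg_right hN hW0

theorem tail_mul_le {t : ℝ} (ht : 0 < t) (ht' : t ≤ 1 / 100) (x y : ℝ) :
    tailBound t x * (Real.exp (-(1.33 / t ^ 3) * y ^ 2) + tailBound t y) ≤
      Real.exp (-0.108 / t) *
        (Real.exp (-(0.13 / t ^ 3) * x ^ 2) * Real.exp (-(1.33 / t ^ 3) * y ^ 2)) +
      Real.exp (-0.108 / t) ^ 2 *
        (Real.exp (-(0.13 / t ^ 3) * x ^ 2) * Real.exp (-(0.13 / t ^ 3) * y ^ 2)) +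
      4 * Real.exp (2 - 0.8 / t) *
        (Real.exp (-(0.009 / t) * x ^ 2) * Real.exp (-(0.009 / t) * y ^ 2)) := by
  have hc1 : Real.exp (-0.108 / t) ≤ 1 := by
    rw [Real.exp_le_one_iff, neg_div, neg_nonpos]; positivity
  have hc2 : Real.exp (2 - 0.8 / t) ≤ 1 := by
    rw [Real.exp_le_one_iff, sub_nonpos, le_div_iff₀ ht]; linarith
  have hEG := gaussian_mono (t := t) (θ := y) ht (a := 0.13) (b := 1.33) (by norm_num)
  have hGN : ∀ θ : ℝ, Real.exp (-(0.13 / t ^ 3) * θ ^ 2) ≤ Real.exp (-(0.009 / t) * θ ^ 2) := by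
    intro θ
    have : 0.009 / t ≤ 0.13 / t ^ 3 := by
      rw [div_le_div_iff₀ ht (by positivity)]
      have : t ^ 2 ≤ 1 := by nlinarith
      nlinarith
    gcongr
  have hx := hGN x
  have hy := hGN y
  unfold tailBound
  have p1 := Real.exp_pos (-0.108 / t)
  have p2 := Real.exp_pos (2 - 0.8 / t)
  have p3 := Real.exp_pos (-(0.13 / t ^ 3) * x ^ 2)
  have p4 := Real.exp_pos (-(0.13 / t ^ 3) * y ^ 2)
  have p5 := Real.exp_pos (-(1.33 / t ^ 3) * y ^ 2)
  generalize Real.exp (-0.108 / t) = c at *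
  generalize Real.exp (2 - 0.8 / t) = d at *
  generalize Real.exp (-(0.13 / t ^ 3) * x ^ 2) = G at *
  generalize Real.exp (-(0.13 / t ^ 3) * y ^ 2) = G' at *
  generalize Real.exp (-(1.33 / t ^ 3) * y ^ 2) = E' at *
  generalize Real.exp (-(0.009 / t) * x ^ 2) = N at *
  generalize Real.exp (-(0.009 / t) * y ^ 2) = N' at *
  have hN : 0 ≤ N := p3.le.trans hx
  have hN' : 0 ≤ N' := p4.le.trans hy
  have q1 : c * (G * N') ≤ N * N' := by
    calc c * (G * N') ≤ 1 * (N * N') := by gcongr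
      _ = _ := one_mul _
  have q2 : N * E' ≤ N * N' := by gcongr; exact hEG.trans hy
  have q3 : c * (N * G') ≤ N * N' := by
    calc c * (N * G') ≤ 1 * (N * N') := by gcongr
      _ = _ := one_mul _
  have q4 : d * (N * N') ≤ N * N' := mul_le_of_le_one_left (by positivity) hc2
  have := mul_le_mul_of_nonneg_left (add_le_add (add_le_add q1 q2) (add_le_add q3 q4)) p2.le
  linarith

theorem exists_hasPlaneIntegral_le_lowerBound {t : ℝ} (ht : 0 < t) (ht' : t ≤ 1 / 100) :
    ∃ B : ℝ × ℝ → ℝ, (∀ z, B z ≤ (z.1 - z.2) ^ 4 * lowerBound t z.1 z.2) ∧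
      HasPlaneIntegral B (0.999 * (3 * Real.pi / (1.645 / t ^ 3) ^ 3) -
        2.725 / t ^ 8 * (101.25 * Real.pi / (1.33 / t ^ 3) ^ 6) -
        (4 * Real.exp (-0.108 / t) * (√(Real.pi / (0.13 / t ^ 3)) * √(Real.pi / (1.33 / t ^ 3)) *
          (3 / 4 * (1 / (0.13 / t ^ 3) + 1 / (1.33 / t ^ 3)) ^ 2)) +
        4 * Real.exp (-0.108 / t) ^ 2 * (3 * Real.pi / (0.13 / t ^ 3) ^ 3) +
        16 * Real.exp (2 - 0.8 / t) * (3 * Real.pi / (0.009 / t) ^ 3))) := by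
  have hdiag : ∀ {p : ℝ}, 0 < p → HasPlaneIntegral (fun z => (z.1 - z.2) ^ 4 *
      (Real.exp (-p * z.1 ^ 2) * Real.exp (-p * z.2 ^ 2))) (3 * Real.pi / p ^ 3) := fun {p} hp =>
    (hasPlaneIntegral_sub_pow_four hp hp).of_eq (fun _ => rfl) (by
      rw [Real.mul_self_sqrt (by positivity)]; field_simp; ring)
  have i1 := hdiag (p := 1.645 / t ^ 3) (by positivity)
  have i2 := hasPlaneIntegral_add_pow_six (p := 1.33 / t ^ 3) (by positivity)
  have i3 := hasPlaneIntegral_sub_pow_four (p := 0.13 / t ^ 3) (q := 1.33 / t ^ 3)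
    (by positivity) (by positivity)
  have i4 := hasPlaneIntegral_sub_pow_four (p := 1.33 / t ^ 3) (q := 0.13 / t ^ 3)
    (by positivity) (by positivity)
  have i5 := hdiag (p := 0.13 / t ^ 3) (by positivity)
  have i6 := hdiag (p := 0.009 / t) (by positivity)
  have h := ((i1.const_mul 0.999).add (i2.const_mul (-(2.725 / t ^ 8)))).add
    ((((i3.add i4).const_mul (-(2 * Real.exp (-0.108 / t)))).add
      (i5.const_mul (-(4 * Real.exp (-0.108 / t) ^ 2)))).add
      (i6.const_mul (-(16 * Real.exp (2 - 0.8 / t)))))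
  refine ⟨_, fun z => ?_, h.of_eq (fun _ => rfl) (by ring)⟩
  have h1 := tail_mul_le ht ht' z.1 z.2
  have h2 := tail_mul_le ht ht' z.2 z.1
  have h3 : 0 ≤ (z.1 - z.2) ^ 4 := by positivity
  have h4 := mul_le_mul_of_nonneg_left (add_le_add h1 h2) h3
  unfold lowerBound
  linarith

theorem exp_neg_le_factorial_div {x : ℝ} (hx : 0 < x) (n : ℕ) :
    Real.exp (-x) ≤ n.factorial / x ^ n := by
  have h := Real.pow_div_factorial_le_exp x hx.le n
  rw [Real.exp_neg, inv_le_comm₀ (Real.exp_pos _) (by positivity), inv_div]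
  exact h

theorem integral_value_pos {t : ℝ} (ht : 0 < t) (ht' : t ≤ 1 / 100) :
    0 < 0.999 * (3 * Real.pi / (1.645 / t ^ 3) ^ 3) -
        2.725 / t ^ 8 * (101.25 * Real.pi / (1.33 / t ^ 3) ^ 6) -
        (4 * Real.exp (-0.108 / t) * (√(Real.pi / (0.13 / t ^ 3)) * √(Real.pi / (1.33 / t ^ 3)) *
          (3 / 4 * (1 / (0.13 / t ^ 3) + 1 / (1.33 / t ^ 3)) ^ 2)) +
        4 * Real.exp (-0.108 / t) ^ 2 * (3 * Real.pi / (0.13 / t ^ 3) ^ 3) +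
        16 * Real.exp (2 - 0.8 / t) * (3 * Real.pi / (0.009 / t) ^ 3)) := by
  have hπ := Real.pi_pos
  have hsqrt : √(Real.pi / (0.13 / t ^ 3)) * √(Real.pi / (1.33 / t ^ 3)) ≤
      Real.pi * t ^ 3 / 0.415 := by
    rw [← Real.sqrt_mul (by positivity)]
    apply Real.sqrt_le_iff.mpr ⟨by positivity, ?_⟩
    have e : Real.pi / (0.13 / t ^ 3) * (Real.pi / (1.33 / t ^ 3)) =
      (Real.pi * t ^ 3) ^ 2 / 0.1729 := by field_simp; norm_num
    rw [e, div_pow]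
    gcongr; norm_num
  have hc : Real.exp (-0.108 / t) ≤ 0.00005 := by
    have h1 : Real.exp (-0.108 / t) ≤ Real.exp (-10) := by
      rw [Real.exp_le_exp, neg_div, neg_le_neg_iff, le_div_iff₀ ht]; linarith
    have h2 : Real.exp (-10) = (Real.exp 1 ^ 10)⁻¹ := by
      rw [Real.exp_neg, ← Real.exp_nat_mul]; norm_num
    have h3 : (2.7 : ℝ) ^ 10 ≤ Real.exp 1 ^ 10 := by
      have := Real.exp_one_gt_d9
      gcongr; linarith
    rw [h2] at h1
    refine h1.trans ((inv_anti₀ (by positivity) h3).trans (by norm_num))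
  have hd : Real.exp (2 - 0.8 / t) ≤ 0.0000000000001 * t ^ 6 := by
    have h1 : Real.exp 2 ≤ 9 := by
      have : Real.exp 2 = Real.exp 1 ^ 2 := by rw [← Real.exp_nat_mul]; norm_num
      rw [this]
      have := Real.exp_one_lt_d9
      calc Real.exp 1 ^ 2 ≤ 3 ^ 2 := by gcongr; linarith
        _ = 9 := by norm_num
    have h2 := exp_neg_le_factorial_div (x := 0.8 / t) (by positivity) 40
    rw [sub_eq_add_neg, Real.exp_add]
    calc Real.exp 2 * Real.exp (-(0.8 / t)) ≤ 9 * ((Nat.factorial 40 : ℝ) / (0.8 / t) ^ 40) := by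
          gcongr
      _ = 9 * (Nat.factorial 40 : ℝ) / 0.8 ^ 40 * t ^ 34 * t ^ 6 := by
          rw [div_pow]; field_simp
      _ ≤ 9 * (Nat.factorial 40 : ℝ) / 0.8 ^ 40 * (1 / 100) ^ 34 * t ^ 6 := by gcongr
      _ ≤ _ := by gcongr; norm_num [Nat.factorial]
  have b1 : 4 * Real.exp (-0.108 / t) * (√(Real.pi / (0.13 / t ^ 3)) * √(Real.pi / (1.33 / t ^ 3)) *
      (3 / 4 * (1 / (0.13 / t ^ 3) + 1 / (1.33 / t ^ 3)) ^ 2)) ≤ 0.05 * (Real.pi * t ^ 9) := by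
    calc _ ≤ 4 * 0.00005 * (Real.pi * t ^ 3 / 0.415 *
          (3 / 4 * (1 / (0.13 / t ^ 3) + 1 / (1.33 / t ^ 3)) ^ 2)) := by gcongr
      _ = 4 * 0.00005 * (1 / 0.415 * (3 / 4 * (1 / 0.13 + 1 / 1.33) ^ 2)) * (Real.pi * t ^ 9) := by
          rw [one_div_div, one_div_div]; ring
      _ ≤ _ := by gcongr; norm_num
  have b2 : 4 * Real.exp (-0.108 / t) ^ 2 * (3 * Real.pi / (0.13 / t ^ 3) ^ 3) ≤
      0.01 * (Real.pi * t ^ 9) := by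
    calc _ ≤ 4 * 0.00005 ^ 2 * (3 * Real.pi / (0.13 / t ^ 3) ^ 3) := by gcongr
      _ = 4 * 0.00005 ^ 2 * (3 / 0.13 ^ 3) * (Real.pi * t ^ 9) := by
          rw [div_pow, ← pow_mul]; field_simp
      _ ≤ _ := by gcongr; norm_num
  have b3 : 16 * Real.exp (2 - 0.8 / t) * (3 * Real.pi / (0.009 / t) ^ 3) ≤
      0.01 * (Real.pi * t ^ 9) := by
    calc _ ≤ 16 * (0.0000000000001 * t ^ 6) * (3 * Real.pi / (0.009 / t) ^ 3) := by gcongr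
      _ = 16 * 0.0000000000001 * (3 / 0.009 ^ 3) * (Real.pi * t ^ 9) := by
          rw [div_pow]; field_simp
      _ ≤ _ := by gcongr; norm_num
  have b4 : 2.725 / t ^ 8 * (101.25 * Real.pi / (1.33 / t ^ 3) ^ 6) ≤ 0.499 * (Real.pi * t ^ 9) := by
    calc _ = 2.725 * 101.25 / 1.33 ^ 6 * t * (Real.pi * t ^ 9) := by
          rw [div_pow, ← pow_mul]; field_simp
      _ ≤ 2.725 * 101.25 / 1.33 ^ 6 * (1 / 100) * (Real.pi * t ^ 9) := by gcongr
      _ ≤ _ := by gcongr; norm_num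
  have b5 : 0.67 * (Real.pi * t ^ 9) ≤ 0.999 * (3 * Real.pi / (1.645 / t ^ 3) ^ 3) := by
    have e : 0.999 * (3 * Real.pi / (1.645 / t ^ 3) ^ 3) =
        0.999 * 3 / 1.645 ^ 3 * (Real.pi * t ^ 9) := by
      rw [div_pow, ← pow_mul]; field_simp
    rw [e]
    gcongr; norm_num
  have : 0 < Real.pi * t ^ 9 := by positivity
  linarith

theorem integral_laguerre {b : ℕ → ℝ} {M : ℕ} {f : ℝ → ℂ}
    (hf : ∀ θ : ℝ, HasSum (fun n => (b n : ℂ) * Complex.exp (((n : ℂ) - M) * θ * Complex.I)) (f θ))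
    (hM : 2 ≤ M) :
    ∫ z in Set.Ioc (-Real.pi) Real.pi ×ˢ Set.Ioc (-Real.pi) Real.pi,
        (f z.1 * f z.2).re * (2 * (1 - Real.cos (z.1 - z.2)) ^ 2) =
      (2 * Real.pi) ^ 2 * (3 * b M ^ 2 - 4 * b (M - 1) * b (M + 1) + b (M - 2) * b (M + 2)) := by
  set ν := MeasureTheory.volume.restrict (Set.Ioc (-Real.pi) Real.pi) with hν
  have hπ : -Real.pi ≤ Real.pi := by linarith [Real.pi_pos]
  have hcont := continuous_of_hasSum hf
  set g : ℤ → ℝ → ℂ := fun j θ => f θ * Complex.exp (j * θ * Complex.I) with hg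
  have hgi : ∀ j, MeasureTheory.Integrable (g j) ν := fun j =>
    (Continuous.intervalIntegrable (by fun_prop) _ _ : IntervalIntegrable (g j)
      MeasureTheory.volume (-Real.pi) Real.pi).1
  have hgv : ∀ j : ℤ, ∀ k : ℕ, (k : ℤ) = M - j → ∫ θ, g j θ ∂ν = 2 * Real.pi * b k := by
    intro j k hk
    rw [← integral_mul_exp_eq hf k, intervalIntegral.integral_of_le hπ]
    have : (j : ℂ) = (M : ℂ) - k := by
      have : j = (M : ℤ) - k := by omega
      rw [this]; push_cast; rfl
    simp only [hg, this, hν]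
  have hprod : ∀ j : ℤ, ∀ k l : ℕ, (k : ℤ) = M - j → (l : ℤ) = M - -j →
      MeasureTheory.Integrable (fun z : ℝ × ℝ => g j z.1 * g (-j) z.2) (ν.prod ν) ∧
      ∫ z, g j z.1 * g (-j) z.2 ∂(ν.prod ν) = (2 * Real.pi) ^ 2 * (b k * b l) := by
    intro j k l hk hl
    refine ⟨(hgi j).mul_prod (hgi (-j)), ?_⟩
    rw [MeasureTheory.integral_prod_mul, hgv j k hk, hgv (-j) l hl]; ring
  have h0 := hprod 0 M M (by omega) (by omega)
  have h1 := hprod 1 (M - 1) (M + 1) (by omega) (by omega)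
  have h1' := hprod (-1) (M + 1) (M - 1) (by omega) (by omega)
  have h2 := hprod 2 (M - 2) (M + 2) (by omega) (by omega)
  have h2' := hprod (-2) (M + 2) (M - 2) (by omega) (by omega)
  have hW : ∀ z : ℝ × ℝ, ((f z.1 * f z.2) * ((2 * (1 - Real.cos (z.1 - z.2)) ^ 2 : ℝ) : ℂ)) =
      3 * (g 0 z.1 * g (-0) z.2) + (-2) * (g 1 z.1 * g (-1) z.2 + g (-1) z.1 * g (- -1) z.2) +
        1 / 2 * (g 2 z.1 * g (-2) z.2 + g (-2) z.1 * g (- -2) z.2) := by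
    intro z
    have e1 : ∀ j : ℤ, g j z.1 * g (-j) z.2 =
        f z.1 * f z.2 * Complex.exp (((z.1 - z.2 : ℝ) : ℂ) * Complex.I) ^ j := by
      intro j
      rw [← Complex.exp_int_mul, hg]
      simp only
      rw [mul_mul_mul_comm, ← Complex.exp_add]
      push_cast
      ring_nf
    simp only [e1]
    have hc : ((Real.cos (z.1 - z.2) : ℝ) : ℂ) =
        (Complex.exp (((z.1 - z.2 : ℝ) : ℂ) * Complex.I) +
          (Complex.exp (((z.1 - z.2 : ℝ) : ℂ) * Complex.I))⁻¹) / 2 := by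
      rw [Complex.ofReal_cos, Complex.cos, ← Complex.exp_neg, neg_mul]
    push_cast [-Complex.ofReal_cos]
    push_cast [-Complex.ofReal_cos] at hc
    rw [← Complex.ofReal_sub] at hc ⊢
    rw [hc]
    have hne := Complex.exp_ne_zero (((z.1 - z.2 : ℝ) : ℂ) * Complex.I)
    generalize Complex.exp (((z.1 - z.2 : ℝ) : ℂ) * Complex.I) = ω at hne
    have e2 : ω ^ (2 : ℤ) = ω ^ 2 := rfl
    have e3 : ω ^ (-2 : ℤ) = (ω ^ 2)⁻¹ := by rw [zpow_neg]; rfl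
    rw [e2, e3, zpow_zero, zpow_one, zpow_neg_one]
    field_simp
    ring
  have hadd : ∀ {u v : ℝ × ℝ → ℂ} {c d : ℂ},
      MeasureTheory.Integrable u (ν.prod ν) ∧ ∫ z, u z ∂(ν.prod ν) = c →
      MeasureTheory.Integrable v (ν.prod ν) ∧ ∫ z, v z ∂(ν.prod ν) = d →
      MeasureTheory.Integrable (fun z => u z + v z) (ν.prod ν) ∧
        ∫ z, u z + v z ∂(ν.prod ν) = c + d := fun hu hv =>
    ⟨hu.1.add hv.1, by rw [MeasureTheory.integral_add hu.1 hv.1, hu.2, hv.2]⟩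
  have hmul : ∀ {u : ℝ × ℝ → ℂ} {c : ℂ} (r : ℂ),
      MeasureTheory.Integrable u (ν.prod ν) ∧ ∫ z, u z ∂(ν.prod ν) = c →
      MeasureTheory.Integrable (fun z => r * u z) (ν.prod ν) ∧
        ∫ z, r * u z ∂(ν.prod ν) = r * c := fun r hu =>
    ⟨hu.1.const_mul r, by rw [MeasureTheory.integral_const_mul, hu.2]⟩
  obtain ⟨hI, hV⟩ := hadd (hadd (hmul 3 h0) (hmul (-2) (hadd h1 h1')))
    (hmul (1 / 2) (hadd h2 h2'))
  simp only [← hW] at hI hV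
  rw [MeasureTheory.Measure.volume_eq_prod, ← MeasureTheory.Measure.prod_restrict, ← hν]
  have h := integral_re hI
  have hR : ((2 * Real.pi) ^ 2 * (3 * b M ^ 2 - 4 * b (M - 1) * b (M + 1) + b (M - 2) * b (M + 2)) :
      ℂ) = (((2 * Real.pi) ^ 2 *
        (3 * b M ^ 2 - 4 * b (M - 1) * b (M + 1) + b (M - 2) * b (M + 2)) : ℝ) : ℂ) := by
    push_cast; rfl
  rw [hV.trans (Eq.trans (by ring) hR)] at h
  simp only [RCLike.re_to_complex, Complex.re_mul_ofReal, Complex.ofReal_re] at h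
  exact h

theorem integrableOn_laguerre {f : ℝ → ℂ} (hf : Continuous f) :
    MeasureTheory.IntegrableOn
      (fun z : ℝ × ℝ => (f z.1 * f z.2).re * (2 * (1 - Real.cos (z.1 - z.2)) ^ 2))
      (Set.Ioc (-Real.pi) Real.pi ×ˢ Set.Ioc (-Real.pi) Real.pi) := by
  have hc : Continuous
      (fun z : ℝ × ℝ => (f z.1 * f z.2).re * (2 * (1 - Real.cos (z.1 - z.2)) ^ 2)) := by
    have : Continuous fun z : ℝ × ℝ => (f z.1 * f z.2).re :=
      Complex.continuous_re.comp (by fun_prop)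
    fun_prop
  exact (hc.continuousOn.integrableOn_compact (isCompact_Icc.prod isCompact_Icc)).mono_set
    (Set.prod_mono Set.Ioc_subset_Icc_self Set.Ioc_subset_Icc_self)

theorem three_tenths_mul_lt_abs_of_notMem {t θ : ℝ} (ht' : t ≤ 1 / 100)
    (h : θ ∉ Set.Ioc (-Real.pi) Real.pi) : 0.3 * t < |θ| := by
  have hπ := Real.pi_gt_three
  rw [Set.mem_Ioc, not_and_or, not_lt, not_le] at h
  rcases h with h | h
  · linarith [neg_le_abs θ]
  · linarith [le_abs_self θ]

theorem integral_charFn_pos {t : ℝ} (ht : 0 < t) (ht' : t ≤ 1 / 100)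
    (hc : Continuous (charFn t)) :
    0 < ∫ z in Set.Ioc (-Real.pi) Real.pi ×ˢ Set.Ioc (-Real.pi) Real.pi,
      (charFn t z.1 * charFn t z.2).re * (2 * (1 - Real.cos (z.1 - z.2)) ^ 2) := by
  obtain ⟨B, hB, hBI⟩ := exists_hasPlaneIntegral_le_lowerBound ht ht'
  have hpos := integral_value_pos ht ht'
  have hms : MeasurableSet (Set.Ioc (-Real.pi) Real.pi ×ˢ Set.Ioc (-Real.pi) Real.pi) :=
    measurableSet_Ioc.prod measurableSet_Ioc
  have hBI' := hBI.const_mul (1 / 2)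
  rw [← MeasureTheory.integral_indicator hms]
  refine lt_of_lt_of_le ?_ (MeasureTheory.integral_mono hBI'.1
    ((MeasureTheory.integrable_indicator_iff hms).mpr (integrableOn_laguerre hc)) fun z => ?_)
  · rw [hBI'.2]
    exact mul_pos (by norm_num) hpos
  · have h1 := mul_le_mul_of_nonneg_left (hB z) (by norm_num : (0 : ℝ) ≤ 1 / 2)
    refine h1.trans ?_
    by_cases hz : z ∈ Set.Ioc (-Real.pi) Real.pi ×ˢ Set.Ioc (-Real.pi) Real.pi
    · rw [Set.indicator_of_mem hz]
      exact lowerBound_mul_le ht ht' (abs_le.mpr ⟨hz.1.1.le, hz.1.2⟩)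
        (abs_le.mpr ⟨hz.2.1.le, hz.2.2⟩)
    · rw [Set.indicator_of_notMem hz]
      rw [Set.mem_prod, not_and_or] at hz
      have h2 : lowerBound t z.1 z.2 ≤ 0 := lowerBound_nonpos_of_far ht
        (hz.imp (three_tenths_mul_lt_abs_of_notMem ht') (three_tenths_mul_lt_abs_of_notMem ht'))
      have : (z.1 - z.2) ^ 4 * lowerBound t z.1 z.2 ≤ 0 :=
        mul_nonpos_of_nonneg_of_nonpos (by positivity) h2
      linarith

theorem laguerre2_dP_large {n : ℕ} (hn : 16685 ≤ n) :
    3 * (dP (n + 2)) ^ 2 - 4 * dP (n + 1) * dP (n + 3) + dP n * dP (n + 4) > 0 := by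
  obtain ⟨t, ht, ht', hM⟩ := exists_saddle (M := n + 3) (by omega)
  have hf := hasSum_charFn ht hM
  have hpos := integral_charFn_pos ht ht' (continuous_of_hasSum hf)
  rw [integral_laguerre hf (by omega)] at hpos
  have hpos' := (mul_pos_iff_of_pos_left (by have := Real.pi_pos; positivity)).mp hpos
  have e1 : n + 3 - 1 = n + 2 := by omega
  have e2 : n + 3 - 2 = n + 1 := by omega
  rw [e1, e2] at hpos'
  have hN : ∀ k, noOnes (k + 1) = dP k := fun _ => rfl
  have hexp : ∀ k : ℕ, Real.exp (-(((n + 1 + k : ℕ) : ℝ) * t)) =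
      Real.exp (-(((n : ℝ) + 1) * t)) * Real.exp (-t) ^ k := fun k => by
    rw [← Real.exp_nat_mul, ← Real.exp_add]; push_cast; ring_nf
  have h1 := hexp 0
  have h2 := hexp 1
  have h3 := hexp 2
  have h4 := hexp 3
  have h5 := hexp 4
  simp only [add_assoc, Nat.reduceAdd] at h1 h2 h3 h4 h5 hpos'
  rw [h1, h2, h3, h4, h5, hN n, hN (n + 1), hN (n + 2), hN (n + 3), hN (n + 4)] at hpos'
  have hS := Real.exp_pos (∑' p, weight t p)
  generalize Real.exp (∑' p, weight t p) = S at hpos' hS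
  have hu := Real.exp_pos (-(((n : ℝ) + 1) * t))
  have hr := Real.exp_pos (-t)
  generalize Real.exp (-(((n : ℝ) + 1) * t)) = u at hpos' hu
  generalize Real.exp (-t) = r at hpos' hr
  have h : 0 < (u * r ^ 2 / S) ^ 2 * (3 * (dP (n + 2) : ℝ) ^ 2 - 4 * dP (n + 1) * dP (n + 3) +
      dP n * dP (n + 4)) := by
    refine hpos'.trans_eq ?_
    field_simp
  have h' := (mul_pos_iff_of_pos_left (by positivity)).mp h
  exact_mod_cast h'

theorem laguerre2_dP (n : ℕ) (hn : 301 ≤ n) :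
    3 * (dP (n + 2)) ^ 2 - 4 * dP (n + 1) * dP (n + 3) + dP n * dP (n + 4) > 0 := by
  rcases lt_or_ge n 16685 with h | h
  · exact laguerre2_dP_small hn h
  · exact laguerre2_dP_large h
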